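/- arXiv:1611.00722 — 4 statements merged into one kernel-verified Lean document; each statement's English description precedes it below -/
import Mathlib

section
/- Let f be a multicritical circle map with irrational rotation number and fixed critical point c₀. There exists n₁ = n₁(f) ∈ ℕ such that for all n ≥ n₁: Sf^j(x) < 0 for all j ∈ {1, …, q_{n+1}} and all x ∈ I_n that are regular points of f^j (i.e., Df^j(x) ≠ 0); and likewise Sf^j(x) < 0 for all j ∈ {1, …, q_n} and all x ∈ I_{n+1} that are regular points of f^j. -/
open Set Filter Topology
open scoped ENNReal

noncomputable section

namespace MCircle

/-- A lift of an orientation-preserving `C³` circle homeomorphism of `S¹ = ℝ/ℤ`: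
a `C³`, strictly increasing map commuting with the unit translation. -/
structure IsCircleMapLift (f : ℝ → ℝ) : Prop where
  smooth : ContDiff ℝ 3 f
  mono : StrictMono f
  periodic : ∀ x : ℝ, f (x + 1) = f x + 1

/-- `c` is a non-flat (power-law) critical point of `f` of criticality `d > 1`:
near `c` we have `f x = f c + φ x * |φ x| ^ (d - 1)` for a `C³` diffeomorphism `φ`
of a neighbourhood `W` of `c` with `φ c = 0`. -/
def IsNonFlatCritPt (f : ℝ → ℝ) (c d : ℝ) : Prop :=
  1 < d ∧ ∃ (W : Set ℝ) (φ : ℝ → ℝ), IsOpen W ∧ c ∈ W ∧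
    ContDiffOn ℝ 3 φ W ∧ φ c = 0 ∧ (∀ x ∈ W, deriv φ x ≠ 0) ∧ InjOn φ W ∧
    ∀ x ∈ W, f x = f c + φ x * |φ x| ^ (d - 1)

/-- `f` is (a lift of) a multicritical circle map: the set of critical points of the
induced circle map, represented in `[0,1)`, is the nonempty finite set `C`, and each
critical point `c ∈ C` is non-flat of criticality `dc c`. -/
def IsMulticriticalLift (f : ℝ → ℝ) (C : Finset ℝ) (dc : ℝ → ℝ) : Prop :=
  IsCircleMapLift f ∧ C.Nonempty ∧ (↑C : Set ℝ) ⊆ Ico (0 : ℝ) 1 ∧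
    (∀ x : ℝ, deriv f x = 0 ↔ ∃ c ∈ C, ∃ k : ℤ, x = c + (k : ℝ)) ∧
    ∀ c ∈ C, IsNonFlatCritPt f c (dc c)

/-- The lift `f` has (translation) rotation number `ρ`. -/
def HasRotNumber (f : ℝ → ℝ) (ρ : ℝ) : Prop :=
  Tendsto (fun n : ℕ => f^[n] 0 / (n : ℝ)) atTop (𝓝 ρ)

/-- `f` is (a lift of) a multicritical circle map with critical set `C` (criticalities
`dc`) and irrational rotation number `ρ`, the lift being normalized so that `ρ ∈ (0,1)`. -/
def GoodMap (f : ℝ → ℝ) (C : Finset ℝ) (dc : ℝ → ℝ) (ρ : ℝ) : Prop :=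
  IsMulticriticalLift f C dc ∧ HasRotNumber f ρ ∧ Irrational ρ ∧ ρ ∈ Ioo (0 : ℝ) 1

/-- The Gauss map. -/
def gaussMap (x : ℝ) : ℝ := Int.fract x⁻¹

/-- The partial quotients `aₙ` of the continued fraction expansion
`ρ = [a₀, a₁, …] = 1/(a₀ + 1/(a₁ + ⋯))`. -/
def cfA (ρ : ℝ) (n : ℕ) : ℕ := ⌊(gaussMap^[n] (Int.fract ρ))⁻¹⌋₊

/-- The denominators `qₙ` of the convergents of `ρ` (the return times):
`q₀ = 1`, `q₁ = a₀`, `q_{n+2} = a_{n+1} q_{n+1} + qₙ`. -/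
def qden (ρ : ℝ) : ℕ → ℕ
  | 0 => 1
  | 1 => cfA ρ 0
  | n + 2 => cfA ρ (n + 1) * qden ρ (n + 1) + qden ρ n

/-- The numerators `pₙ` of the convergents of `ρ`:
`p₀ = 0`, `p₁ = 1`, `p_{n+2} = a_{n+1} p_{n+1} + pₙ`. -/
def pnum (ρ : ℝ) : ℕ → ℕ
  | 0 => 0
  | 1 => 1
  | n + 2 => cfA ρ (n + 1) * pnum ρ (n + 1) + pnum ρ n

/-- The lift representative of the `n`-th closest return `f^{qₙ}(x)`,
normalized (by the integer `pₙ`) to lie at distance less than one from `x`. -/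
def retPt (f : ℝ → ℝ) (ρ x : ℝ) (n : ℕ) : ℝ := f^[qden ρ n] x - (pnum ρ n : ℝ)

/-- The arc `Iₙ(x)`, with endpoints `x` and `f^{qₙ}(x)` and containing `f^{q_{n+2}}(x)`,
realized as an interval in the lift. -/
def arcI (f : ℝ → ℝ) (ρ x : ℝ) (n : ℕ) : Set ℝ := uIcc x (retPt f ρ x n)

/-- The length `|Iₙ(x)|`. -/
def arcLen (f : ℝ → ℝ) (ρ x : ℝ) (n : ℕ) : ℝ := |retPt f ρ x n - x|

/-- The length `|f^j(Iₙ(x))|`. -/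
def arcImgLen (f : ℝ → ℝ) (ρ x : ℝ) (n j : ℕ) : ℝ :=
  |f^[j] (retPt f ρ x n) - f^[j] x|

/-- Indices for the atoms of the `n`-th dynamical partition
`𝒫ₙ(x) = {fⁱ(Iₙ(x)) : 0 ≤ i ≤ q_{n+1}-1} ∪ {f^j(I_{n+1}(x)) : 0 ≤ j ≤ qₙ-1}`. -/
abbrev AtomIdx (ρ : ℝ) (n : ℕ) : Type :=
  {i : ℕ // i < qden ρ (n + 1)} ⊕ {j : ℕ // j < qden ρ n}

/-- Left endpoint (in the lift) of an atom of `𝒫ₙ(x)`. -/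
def atomL (f : ℝ → ℝ) (ρ x : ℝ) (n : ℕ) : AtomIdx ρ n → ℝ
  | Sum.inl i => min (f^[i.1] x) (f^[i.1] (retPt f ρ x n))
  | Sum.inr j => min (f^[j.1] x) (f^[j.1] (retPt f ρ x (n + 1)))

/-- Right endpoint (in the lift) of an atom of `𝒫ₙ(x)`. -/
def atomR (f : ℝ → ℝ) (ρ x : ℝ) (n : ℕ) : AtomIdx ρ n → ℝ
  | Sum.inl i => max (f^[i.1] x) (f^[i.1] (retPt f ρ x n))
  | Sum.inr j => max (f^[j.1] x) (f^[j.1] (retPt f ρ x (n + 1)))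

/-- Length of an atom of `𝒫ₙ(x)`. -/
def atomLen (f : ℝ → ℝ) (ρ x : ℝ) (n : ℕ) (A : AtomIdx ρ n) : ℝ :=
  atomR f ρ x n A - atomL f ρ x n A

/-- Two lift points represent the same point of the circle `ℝ/ℤ`. -/
def SameCirclePt (a b : ℝ) : Prop := ∃ m : ℤ, a = b + (m : ℝ)

/-- Two atoms of `𝒫ₙ(x)` are adjacent: they are distinct and share an endpoint
on the circle. -/
def AdjacentAtoms (f : ℝ → ℝ) (ρ x : ℝ) (n : ℕ) (A B : AtomIdx ρ n) : Prop :=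
  A ≠ B ∧ ∃ p ∈ ({atomL f ρ x n A, atomR f ρ x n A} : Set ℝ),
    ∃ q ∈ ({atomL f ρ x n B, atomR f ρ x n B} : Set ℝ), SameCirclePt p q

/-- `A` is the left neighbour of `Δ` in `𝒫ₙ(x)`. -/
def IsLeftNbr (f : ℝ → ℝ) (ρ x : ℝ) (n : ℕ) (A Δ : AtomIdx ρ n) : Prop :=
  A ≠ Δ ∧ SameCirclePt (atomR f ρ x n A) (atomL f ρ x n Δ)

/-- `B` is the right neighbour of `Δ` in `𝒫ₙ(x)`. -/
def IsRightNbr (f : ℝ → ℝ) (ρ x : ℝ) (n : ℕ) (B Δ : AtomIdx ρ n) : Prop :=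
  B ≠ Δ ∧ SameCirclePt (atomL f ρ x n B) (atomR f ρ x n Δ)

/-- The arc `f^j(Δ)` is contained (as a circle arc) in some element of `𝒫ₙ(x)`. -/
def ImgInAtom (f : ℝ → ℝ) (ρ x : ℝ) (n j : ℕ) (Δ : AtomIdx ρ n) : Prop :=
  ∃ E : AtomIdx ρ n, ∃ m : ℤ,
    atomL f ρ x n E + (m : ℝ) ≤ f^[j] (atomL f ρ x n Δ) ∧
    f^[j] (atomR f ρ x n Δ) ≤ atomR f ρ x n E + (m : ℝ)

/-- An atom of `𝒫ₙ(x)` as a subset of the circle `ℝ/ℤ`. -/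
def atomSetC (f : ℝ → ℝ) (ρ x : ℝ) (n : ℕ) (A : AtomIdx ρ n) : Set (AddCircle (1 : ℝ)) :=
  (fun y : ℝ => (y : AddCircle (1 : ℝ))) '' Icc (atomL f ρ x n A) (atomR f ρ x n A)

/-- The interval `Tₙ = I_{n+1} ∪ Iₙ ∪ f^{qₙ}(Iₙ)`, realized in the lift. -/
def Tset (f : ℝ → ℝ) (ρ x : ℝ) (n : ℕ) : Set ℝ :=
  arcI f ρ x (n + 1) ∪ arcI f ρ x n ∪
    (fun z => f^[qden ρ n] z - (pnum ρ n : ℝ)) '' arcI f ρ x n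

/-- `j` is a critical time: `f^j(Tₙ)` contains a critical point of `f` (mod 1). -/
def IsCritTime (f : ℝ → ℝ) (ρ x : ℝ) (C : Finset ℝ) (n j : ℕ) : Prop :=
  ∃ c ∈ C, ∃ m : ℤ, c + (m : ℝ) ∈ f^[j] '' Tset f ρ x n

/-- The cross-ratio `[M,T] = |L||R|/(|L∪M||M∪R|)` of the configuration
`M = [b,c] ⋐ T = [a,d]` (so `L = [a,b]`, `R = [c,d]`). -/
def crossRatio (a b c d : ℝ) : ℝ := ((b - a) * (d - c)) / ((c - a) * (d - b))

/-- The cross-ratio distortion `CrD(g; M, T)` of `g` on the configuration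
`M = [b,c] ⋐ T = [a,d]`. -/
def crD (g : ℝ → ℝ) (a b c d : ℝ) : ℝ :=
  crossRatio (g a) (g b) (g c) (g d) / crossRatio a b c d

/-- The Schwarzian derivative `Sg = g'''/g' - (3/2)(g''/g')²`. -/
def schwarzian (g : ℝ → ℝ) (x : ℝ) : ℝ :=
  iteratedDeriv 3 g x / deriv g x - (3 / 2) * (iteratedDeriv 2 g x / deriv g x) ^ 2

/-- `g` is a diffeomorphism on `S` with distortion bounded by `K`. -/
def DiffeoWithDistortionLE (g : ℝ → ℝ) (S : Set ℝ) (K : ℝ) : Prop :=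
  ContDiffOn ℝ 1 g S ∧ InjOn g S ∧ (∀ x ∈ S, deriv g x ≠ 0) ∧
    ∀ x ∈ S, ∀ y ∈ S, |deriv g x| ≤ K * |deriv g y|

/-- `g` is a diffeomorphism on `S` with negative Schwarzian derivative. -/
def NegSchwarzDiffeoOn (g : ℝ → ℝ) (S : Set ℝ) : Prop :=
  ContDiffOn ℝ 3 g S ∧ InjOn g S ∧ ∀ x ∈ S, deriv g x ≠ 0 ∧ schwarzian g x < 0

/-- The local quasi-symmetric distortion
`σ_h(x) = lim_{δ→0} limsup_{|t|≤δ} |h(x+t)-h(x)|/|h(x)-h(x-t)|` of a circle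
homeomorphism lift `h`, with values in `[0,∞]`. -/
def qsDistortion (h : ℝ → ℝ) (x : ℝ) : ℝ≥0∞ :=
  Filter.limsup
    (fun t : ℝ => ENNReal.ofReal (|h (x + t) - h x| / |h x - h (x - t)|))
    (𝓝[≠] (0 : ℝ))

end MCircle

namespace MCircle

/-- The length scale `θₙ = |qₙ ρ - pₙ|` of the `n`-th closest return. -/
def theta (ρ : ℝ) (n : ℕ) : ℝ := (-1) ^ n * ((qden ρ n : ℝ) * ρ - (pnum ρ n : ℝ))

lemma gaussMap_iterate_mem {ρ : ℝ} (h : Irrational ρ) (n : ℕ) :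
    Irrational (gaussMap^[n] (Int.fract ρ)) ∧ gaussMap^[n] (Int.fract ρ) ∈ Ioo (0 : ℝ) 1 := by
  have key : ∀ x : ℝ, Irrational x → Irrational (Int.fract x) ∧ Int.fract x ∈ Ioo (0 : ℝ) 1 := by
    intro x hx
    have h1 : Irrational (Int.fract x) := by
      rw [Int.fract]
      exact hx.sub_intCast _
    exact ⟨h1, lt_of_le_of_ne (Int.fract_nonneg x) (fun h0 => h1.ne_zero h0.symm),
      Int.fract_lt_one x⟩
  induction n with
  | zero => exact key ρ h
  | succ n ih =>
    rw [Function.iterate_succ_apply']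
    exact key _ ih.1.inv

lemma gaussMap_iterate_succ {ρ : ℝ} (n : ℕ) (h : Irrational ρ) :
    gaussMap^[n + 1] (Int.fract ρ) = (gaussMap^[n] (Int.fract ρ))⁻¹ - (cfA ρ n : ℝ) := by
  have h1 := (gaussMap_iterate_mem h n).2.1
  rw [Function.iterate_succ_apply', gaussMap, cfA, Int.fract,
    natCast_floor_eq_intCast_floor (inv_nonneg.2 h1.le)]

lemma theta_succ {ρ : ℝ} (h : Irrational ρ) (h01 : ρ ∈ Ioo (0 : ℝ) 1) (n : ℕ) :
    theta ρ (n + 1) = gaussMap^[n + 1] (Int.fract ρ) * theta ρ n := by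
  induction n with
  | zero =>
    have hfr : Int.fract ρ = ρ := Int.fract_eq_self.2 ⟨h01.1.le, h01.2⟩
    rw [gaussMap_iterate_succ 0 h]
    have : ρ ≠ 0 := h01.1.ne'
    simp only [theta, qden, pnum, Function.iterate_zero, id, hfr]
    field_simp
    push_cast
    ring
  | succ n ih =>
    rw [gaussMap_iterate_succ (n + 1) h]
    have h1 := (gaussMap_iterate_mem h (n + 1)).2.1
    have h2 : theta ρ (n + 2) = theta ρ n - cfA ρ (n + 1) * theta ρ (n + 1) := by
      simp only [theta, qden, pnum]
      push_cast
      ring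
    rw [h2, sub_mul]
    congr 1
    rw [ih]
    field_simp

lemma theta_pos {ρ : ℝ} (h : Irrational ρ) (h01 : ρ ∈ Ioo (0 : ℝ) 1) (n : ℕ) :
    0 < theta ρ n := by
  induction n with
  | zero => simpa [theta, qden, pnum] using h01.1
  | succ n ih =>
    rw [theta_succ h h01]
    exact mul_pos (gaussMap_iterate_mem h _).2.1 ih

lemma theta_succ_lt {ρ : ℝ} (h : Irrational ρ) (h01 : ρ ∈ Ioo (0 : ℝ) 1) (n : ℕ) :
    theta ρ (n + 1) < theta ρ n := by
  rw [theta_succ h h01]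
  exact mul_lt_of_lt_one_left (theta_pos h h01 n) (gaussMap_iterate_mem h _).2.2

lemma theta_antitone {ρ : ℝ} (h : Irrational ρ) (h01 : ρ ∈ Ioo (0 : ℝ) 1) :
    Antitone (theta ρ) :=
  antitone_nat_of_succ_le fun n => (theta_succ_lt h h01 n).le

lemma theta_lt_one {ρ : ℝ} (h : Irrational ρ) (h01 : ρ ∈ Ioo (0 : ℝ) 1) (n : ℕ) :
    theta ρ n < 1 := by
  refine (theta_antitone h h01 (Nat.zero_le n)).trans_lt ?_
  simpa [theta, qden, pnum] using h01.2

lemma one_le_cfA {ρ : ℝ} (h : Irrational ρ) (n : ℕ) : 1 ≤ cfA ρ n := by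
  have h1 := (gaussMap_iterate_mem h n).2
  rw [cfA, Nat.one_le_floor_iff]
  exact (one_lt_inv₀ h1.1).2 h1.2 |>.le

lemma two_mul_theta_le {ρ : ℝ} (h : Irrational ρ) (h01 : ρ ∈ Ioo (0 : ℝ) 1) (n : ℕ) :
    2 * theta ρ (n + 2) ≤ theta ρ n := by
  have h2 : theta ρ (n + 2) = theta ρ n - cfA ρ (n + 1) * theta ρ (n + 1) := by
    simp only [theta, qden, pnum]
    push_cast
    ring
  have h3 : (1 : ℝ) ≤ cfA ρ (n + 1) := by exact_mod_cast one_le_cfA h (n + 1)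
  have h4 := theta_succ_lt h h01 (n + 1)
  have h5 := theta_pos h h01 (n + 1)
  nlinarith

lemma qden_pos {ρ : ℝ} (h : Irrational ρ) (n : ℕ) : 0 < qden ρ n ∧ 0 < qden ρ (n + 1) := by
  induction n with
  | zero => exact ⟨by simp [qden], one_le_cfA h 0⟩
  | succ n ih => exact ⟨ih.2, by simp only [qden]; omega⟩

lemma qden_le_succ {ρ : ℝ} (h : Irrational ρ) (n : ℕ) : qden ρ n ≤ qden ρ (n + 1) := by
  cases n with
  | zero => exact one_le_cfA h 0
  | succ n =>
    simp only [qden]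
    nlinarith [one_le_cfA h (n + 1)]

lemma pnum_qden_det (ρ : ℝ) (n : ℕ) :
    (pnum ρ (n + 1) : ℤ) * qden ρ n - pnum ρ n * qden ρ (n + 1) = (-1) ^ n := by
  induction n with
  | zero => simp [pnum, qden]
  | succ n ih =>
    have : (-1 : ℤ) ^ (n + 1) =
        -((pnum ρ (n + 1) : ℤ) * qden ρ n - pnum ρ n * qden ρ (n + 1)) := by
      rw [ih]; ring
    rw [this]
    simp only [pnum, qden]
    push_cast
    ring

/-- Best approximation: no `k < q_{n+1}` returns closer than `θₙ`. -/
lemma theta_le_abs {ρ : ℝ} (h : Irrational ρ) (h01 : ρ ∈ Ioo (0 : ℝ) 1) (n : ℕ) {k l : ℤ}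
    (hk : 0 < k) (hk' : k < qden ρ (n + 1)) : theta ρ n ≤ |(k : ℝ) * ρ + l| := by
  have hdet := pnum_qden_det ρ n
  have hq := (qden_pos h n).1
  have hq' := (qden_pos h n).2
  obtain ⟨s, hs⟩ : ∃ s : ℤ, s = (-1) ^ n := ⟨_, rfl⟩
  have hs2 : s * s = 1 := by rw [hs, ← pow_add, ← two_mul, pow_mul]; simp
  rw [← hs] at hdet
  obtain ⟨a, ha⟩ : ∃ a : ℤ, a = s * (k * pnum ρ (n + 1) + l * qden ρ (n + 1)) := ⟨_, rfl⟩
  obtain ⟨b, hb⟩ : ∃ b : ℤ, b = -s * (k * pnum ρ n + l * qden ρ n) := ⟨_, rfl⟩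
  have hk2 : k = a * qden ρ n + b * qden ρ (n + 1) := by
    rw [ha, hb]; linear_combination (-s * k) * hdet - k * hs2
  have hl2 : l = -(a * pnum ρ n + b * pnum ρ (n + 1)) := by
    rw [ha, hb]; linear_combination (-s * l) * hdet - l * hs2
  have e0 : ((-1 : ℝ) ^ n) * (-1) ^ n = 1 := by rw [← pow_add, ← two_mul, pow_mul]; simp
  have key : (k : ℝ) * ρ + l = (-1) ^ n * (a * theta ρ n - b * theta ρ (n + 1)) := by
    rw [hk2, hl2]
    simp only [theta, pow_succ]
    push_cast
    linear_combination (-(a * (qden ρ n * ρ - pnum ρ n) +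
      b * (qden ρ (n + 1) * ρ - pnum ρ (n + 1)) : ℝ)) * e0
  rw [key, abs_mul, abs_pow, abs_neg, abs_one, one_pow, one_mul]
  have t0 := theta_pos h h01 n
  have t1 := theta_pos h h01 (n + 1)
  have hq1 : (0 : ℤ) < qden ρ n := by exact_mod_cast hq
  have hq2 : (0 : ℤ) < qden ρ (n + 1) := by exact_mod_cast hq'
  rcases lt_trichotomy a 0 with h1 | h1 | h1
  · have hb1 : 0 < b := by
      by_contra hb0
      nlinarith
    have a1 : (a : ℝ) ≤ -1 := by exact_mod_cast (by omega : a ≤ -1)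
    have b1 : (0 : ℝ) < b := by exact_mod_cast hb1
    rw [le_abs]; right
    nlinarith
  · exfalso
    rw [h1, zero_mul, zero_add] at hk2
    rcases le_or_gt b 0 with hb0 | hb0
    · nlinarith
    · nlinarith
  · have hb1 : b ≤ 0 := by
      by_contra hb0
      nlinarith
    have a1 : (1 : ℝ) ≤ a := by exact_mod_cast h1
    have b1 : (b : ℝ) ≤ 0 := by exact_mod_cast hb1
    rw [le_abs]; left
    nlinarith

/-- The displacement `kρ + m` of the rotation lift indexed by `(k, m)`. -/
def rot (ρ : ℝ) (p : ℤ × ℤ) : ℝ := (p.1 : ℝ) * ρ + p.2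

/-- The action of `ℤ × ℤ` on the line by the iterates `f^k + m` of an invertible lift `f`
with irrational rotation number `ρ`, ordered on each orbit as under the rigid rotation. -/
structure IsRotAction (f : ℝ → ℝ) (ρ : ℝ) (act : ℤ × ℤ → ℝ → ℝ) : Prop where
  add : ∀ p q x, act (p + q) x = act p (act q x)
  zero : ∀ x, act 0 x = x
  lt_of_rot_lt : ∀ p q x, rot ρ p < rot ρ q → act p x < act q x
  strictMono : ∀ p, StrictMono (act p)
  continuous : ∀ p, Continuous (act p)
  nat : ∀ (n : ℕ) x, act (n, 0) x = f^[n] x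
  int : ∀ (k m : ℤ) x, act (k, m) x = act (k, 0) x + m
  translate : ∀ p x (m : ℤ), act p (x + m) = act p x + m

lemma exists_isRotAction {f : ℝ → ℝ} {C : Finset ℝ} {dc : ℝ → ℝ} {ρ : ℝ}
    (hf : GoodMap f C dc ρ) : ∃ act, IsRotAction f ρ act := by
  obtain ⟨⟨hl, -, -, -, -⟩, hrot, hirr, -⟩ := hf
  let F : CircleDeg1Lift := ⟨⟨f, hl.mono.monotone⟩, hl.periodic⟩
  have hF : ∀ x, F x = f x := fun _ => rfl
  have hsurj : Function.Surjective F :=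
    F.continuous_iff_surjective.1 hl.smooth.continuous
  obtain ⟨u, hu⟩ : IsUnit F := CircleDeg1Lift.isUnit_iff_bijective.2 ⟨hl.mono.injective, hsurj⟩
  have hτ : CircleDeg1Lift.translationNumber (u : CircleDeg1Lift) = ρ := by
    rw [hu]
    refine tendsto_nhds_unique F.tendsto_translation_number₀ ?_
    have : (fun n : ℕ => (F ^ n) 0 / (n : ℝ)) = fun n : ℕ => f^[n] 0 / (n : ℝ) := by
      funext n
      rw [CircleDeg1Lift.coe_pow]
      rfl
    rw [this]
    exact hrot
  let v : ℤ → CircleDeg1Lift := fun k => ((u ^ k : CircleDeg1Liftˣ) : CircleDeg1Lift)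
  have hv_add : ∀ a b x, v (a + b) x = v a (v b x) := fun a b x => by
    simp only [v, zpow_add, Units.val_mul, CircleDeg1Lift.mul_apply]
  have hv_mono : ∀ k, StrictMono (v k) := fun k => by
    have := (CircleDeg1Lift.toOrderIso (u ^ k)).strictMono
    rwa [CircleDeg1Lift.coe_toOrderIso] at this
  have hv_cont : ∀ k, Continuous (v k) := fun k => by
    have := (CircleDeg1Lift.toOrderIso (u ^ k)).continuous
    rwa [CircleDeg1Lift.coe_toOrderIso] at this
  have hv_rot : ∀ k : ℤ, CircleDeg1Lift.translationNumber (v k) = k * ρ := fun k => by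
    rw [← hτ]; exact CircleDeg1Lift.translationNumber_zpow u k
  refine ⟨fun p x => v p.1 x + p.2, ?_, ?_, ?_, ?_, ?_, ?_, ?_, ?_⟩
  · intro p q x
    simp only [Prod.fst_add, Prod.snd_add, hv_add, CircleDeg1Lift.map_add_int]
    push_cast
    ring
  · intro x
    simp [v]
  · intro p q x h
    have h1 : CircleDeg1Lift.translationNumber (v (p.1 - q.1)) < ((q.2 - p.2 : ℤ) : ℝ) := by
      rw [hv_rot]
      simp only [rot] at h
      push_cast
      linarith
    have h2 := CircleDeg1Lift.map_lt_of_translationNumber_lt_int _ h1 (v q.1 x)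
    rw [← hv_add, sub_add_cancel] at h2
    push_cast at h2
    show v p.1 x + p.2 < v q.1 x + q.2
    linarith
  · intro p x y h
    exact add_lt_add_left (hv_mono p.1 h) _
  · intro p
    exact (hv_cont p.1).add continuous_const
  · intro n x
    simp only [v, zpow_natCast, Units.val_pow_eq_pow_val, CircleDeg1Lift.coe_pow, hu,
      Int.cast_zero, add_zero]
    rfl
  · intro k m x
    simp
  · intro p x m
    simp only [CircleDeg1Lift.map_add_int]
    ring

/-- The index of the closest return `f^{± qₙ} ∓ pₙ`, signed so as to move points to the right. -/
def gam (ρ : ℝ) (n : ℕ) : ℤ × ℤ := ((-1) ^ n * qden ρ n, -((-1) ^ n * pnum ρ n))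

lemma rot_gam (ρ : ℝ) (n : ℕ) : rot ρ (gam ρ n) = theta ρ n := by
  simp only [rot, gam, theta]
  push_cast
  ring

lemma rot_add (ρ : ℝ) (p q : ℤ × ℤ) : rot ρ (p + q) = rot ρ p + rot ρ q := by
  simp only [rot, Prod.fst_add, Prod.snd_add]
  push_cast
  ring

lemma rot_smul (ρ : ℝ) (k : ℤ) (p : ℤ × ℤ) : rot ρ (k • p) = k * rot ρ p := by
  simp only [rot, Prod.smul_fst, Prod.smul_snd, smul_eq_mul]
  push_cast
  ring

lemma rot_one (ρ : ℝ) : rot ρ (0, 1) = 1 := by simp [rot]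

namespace IsRotAction

variable {f : ℝ → ℝ} {ρ : ℝ} {act : ℤ × ℤ → ℝ → ℝ}

lemma comm (H : IsRotAction f ρ act) (p q : ℤ × ℤ) (x : ℝ) :
    act p (act q x) = act q (act p x) := by
  rw [← H.add, ← H.add, add_comm]

lemma lt_iff (H : IsRotAction f ρ act) (p q : ℤ × ℤ) (x : ℝ) (hρ : Irrational ρ) :
    act p x < act q x ↔ rot ρ p < rot ρ q := by
  refine ⟨fun h => ?_, H.lt_of_rot_lt p q x⟩
  by_contra hcon
  rcases (not_lt.1 hcon).lt_or_eq with h1 | h1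
  · exact (H.lt_of_rot_lt q p x h1).not_gt h
  · have h2 : p.1 = q.1 := by
      by_contra hne
      simp only [rot] at h1
      have h3 : ρ = ((p.2 - q.2 : ℤ) : ℝ) / ((q.1 - p.1 : ℤ) : ℝ) := by
        have : ((q.1 - p.1 : ℤ) : ℝ) ≠ 0 := by
          exact_mod_cast sub_ne_zero.2 (Ne.symm hne)
        rw [eq_div_iff this]
        push_cast
        linarith
      exact hρ ⟨((p.2 - q.2 : ℤ) : ℚ) / ((q.1 - p.1 : ℤ) : ℚ), by rw [h3]; push_cast; rfl⟩
    have h3 : p.2 = q.2 := by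
      simp only [rot, h2] at h1
      exact_mod_cast (add_left_cancel h1).symm
    have : p = q := Prod.ext h2 h3
    rw [this] at h
    exact lt_irrefl _ h

lemma le_of_rot_le (H : IsRotAction f ρ act) (hρ : Irrational ρ) {p q : ℤ × ℤ} (x : ℝ)
    (h : rot ρ p ≤ rot ρ q) : act p x ≤ act q x := by
  rw [← not_lt] at h ⊢
  rwa [H.lt_iff _ _ _ hρ]

/-- The `j`-fold closest return of level `n`, moving points to the right for `j > 0`. -/
lemma smul_lt (H : IsRotAction f ρ act) (hρ : Irrational ρ) (h01 : ρ ∈ Ioo (0 : ℝ) 1) (n : ℕ)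
    {i j : ℤ} (hij : i < j) (x : ℝ) : act (i • gam ρ n) x < act (j • gam ρ n) x := by
  refine H.lt_of_rot_lt _ _ _ ?_
  rw [rot_smul, rot_smul, rot_gam]
  have : (i : ℝ) < j := by exact_mod_cast hij
  nlinarith [theta_pos hρ h01 n]

lemma smul_le (H : IsRotAction f ρ act) (hρ : Irrational ρ) (h01 : ρ ∈ Ioo (0 : ℝ) 1) (n : ℕ)
    {i j : ℤ} (hij : i ≤ j) (x : ℝ) : act (i • gam ρ n) x ≤ act (j • gam ρ n) x := by
  rcases hij.lt_or_eq with h | h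
  · exact (H.smul_lt hρ h01 n h x).le
  · rw [h]

lemma add_smul (H : IsRotAction f ρ act) (n : ℕ) (i j : ℤ) (x : ℝ) :
    act (i • gam ρ n) (act (j • gam ρ n) x) = act ((i + j) • gam ρ n) x := by
  rw [← H.add, _root_.add_smul]

end IsRotAction

/-- The length of `[a, d)` plus the number of points of `X` it contains modulo `1`. -/
def weight (X : Finset ℝ) (a d : ℝ) : ℝ :=
  (d - a) + ∑ s ∈ X, indicator {s : ℝ | ∃ m : ℤ, s + m ∈ Ico a d} (fun _ => (1 : ℝ)) s

lemma weight_nonneg (X : Finset ℝ) {a d : ℝ} (h : a ≤ d) : 0 ≤ weight X a d :=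
  add_nonneg (sub_nonneg.2 h)
    (Finset.sum_nonneg fun s _ => indicator_nonneg (fun _ _ => zero_le_one) s)

lemma sub_le_weight (X : Finset ℝ) (a d : ℝ) : d - a ≤ weight X a d :=
  le_add_of_nonneg_right
    (Finset.sum_nonneg fun s _ => indicator_nonneg (fun _ _ => zero_le_one) s)

lemma weight_le_add (X : Finset ℝ) {a b c : ℝ} : weight X a c ≤ weight X a b + weight X b c := by
  have : ∑ s ∈ X, indicator {s : ℝ | ∃ m : ℤ, s + m ∈ Ico a c} (fun _ => (1 : ℝ)) s ≤
      ∑ s ∈ X, indicator {s : ℝ | ∃ m : ℤ, s + m ∈ Ico a b} (fun _ => (1 : ℝ)) s +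
      ∑ s ∈ X, indicator {s : ℝ | ∃ m : ℤ, s + m ∈ Ico b c} (fun _ => (1 : ℝ)) s := by
    rw [← Finset.sum_add_distrib]
    refine Finset.sum_le_sum fun s _ => ?_
    classical
    simp only [indicator_apply, mem_ofPred_eq]
    by_cases h : ∃ m : ℤ, s + m ∈ Ico a c
    · obtain ⟨m, hm⟩ := h
      rcases lt_or_ge (s + m) b with hb | hb
      · rw [if_pos ⟨m, hm⟩, if_pos ⟨m, hm.1, hb⟩]
        split_ifs <;> norm_num
      · have h2 : ∃ m : ℤ, s + m ∈ Ico b c := ⟨m, hb, hm.2⟩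
        rw [if_pos ⟨m, hm⟩, if_pos h2]
        split_ifs <;> norm_num
    · rw [if_neg h]
      split_ifs <;> norm_num
  simp only [weight]
  linarith

namespace IsRotAction

variable {f : ℝ → ℝ} {ρ : ℝ} {act : ℤ × ℤ → ℝ → ℝ}

/-- The arcs `f^i [x, act γₙ x)` with `0 ≤ i < q_{n+1}` are pairwise disjoint on the circle. -/
lemma eq_of_mem_Ico (H : IsRotAction f ρ act) (hρ : Irrational ρ) (h01 : ρ ∈ Ioo (0 : ℝ) 1)
    (n : ℕ) {i j : ℕ} (hi : i < qden ρ (n + 1)) (hj : j < qden ρ (n + 1)) {m m' : ℤ} {x y : ℝ}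
    (h1 : y ∈ Ico (act (i, m) x) (act (i, m) (act (gam ρ n) x)))
    (h2 : y ∈ Ico (act (j, m') x) (act (j, m') (act (gam ρ n) x))) : i = j ∧ m = m' := by
  have e1 : act ((i : ℤ), m) x < act (((j : ℤ), m') + gam ρ n) x := by
    rw [H.add]; exact h1.1.trans_lt h2.2
  have e2 : act ((j : ℤ), m') x < act (((i : ℤ), m) + gam ρ n) x := by
    rw [H.add]; exact h2.1.trans_lt h1.2
  rw [H.lt_iff _ _ _ hρ, rot_add, rot_gam] at e1 e2
  simp only [rot] at e1 e2
  push_cast at e1 e2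
  rcases lt_trichotomy i j with h | h | h
  · exfalso
    have := theta_le_abs hρ h01 n (k := (j : ℤ) - i) (l := m' - m) (by omega) (by omega)
    refine this.not_gt (abs_lt.2 ⟨?_, ?_⟩) <;> push_cast <;> linarith
  · refine ⟨h, ?_⟩
    subst h
    have h3 := theta_lt_one hρ h01 n
    have h4 : m < m' + 1 := by
      have : (m : ℝ) < m' + 1 := by linarith
      exact_mod_cast this
    have h5 : m' < m + 1 := by
      have : (m' : ℝ) < m + 1 := by linarith
      exact_mod_cast this
    omega
  · exfalso
    have := theta_le_abs hρ h01 n (k := (i : ℤ) - j) (l := m - m') (by omega) (by omega)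
    refine this.not_gt (abs_lt.2 ⟨?_, ?_⟩) <;> push_cast <;> linarith

lemma sum_length_le (H : IsRotAction f ρ act) (hρ : Irrational ρ) (h01 : ρ ∈ Ioo (0 : ℝ) 1)
    (n : ℕ) (x : ℝ) :
    ∑ i ∈ Finset.range (qden ρ (n + 1)), (f^[i] (act (gam ρ n) x) - f^[i] x) ≤ 2 := by
  obtain ⟨m, hm⟩ : ∃ m : ℕ → ℤ, ∀ i, m i = -⌊f^[i] x⌋ := ⟨_, fun _ => rfl⟩
  obtain ⟨A, hA⟩ : ∃ A : ℕ → Set ℝ, ∀ i : ℕ, A i =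
    Ico (act (i, m i) x) (act (i, m i) (act (gam ρ n) x)) := ⟨_, fun _ => rfl⟩
  have hle : x ≤ act (gam ρ n) x := by
    have := H.smul_le hρ h01 n (zero_le_one) x
    rwa [zero_smul, one_smul, H.zero] at this
  have hlen : ∀ i : ℕ, act (i, m i) (act (gam ρ n) x) - act (i, m i) x =
      f^[i] (act (gam ρ n) x) - f^[i] x := fun i => by
    rw [H.int i (m i), H.int i (m i) x, H.nat, H.nat]; ring
  have hsub : ∀ i, A i ⊆ Ico 0 2 := by
    intro i y hy
    rw [hA] at hy
    have h1 : act (i, m i) x = Int.fract (f^[i] x) := by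
      rw [H.int, H.nat, hm, Int.fract]; push_cast; ring
    have h2 : act (i, m i) (act (gam ρ n) x) ≤ act (i, m i) x + 1 := by
      have h3 := H.strictMono (i, m i) |>.monotone
        (H.le_of_rot_le hρ (p := gam ρ n) (q := (0, 1)) x (by
          rw [rot_gam, rot_one]; exact (theta_lt_one hρ h01 n).le))
      rwa [← H.add, ← H.add, add_comm _ ((0 : ℤ), (1 : ℤ)), H.add (0, 1),
        H.int 0 1, Int.cast_one, show ((0 : ℤ), (0 : ℤ)) = 0 from rfl, H.zero, H.add] at h3
    have h4 := Int.fract_nonneg (f^[i] x)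
    have h5 := Int.fract_lt_one (f^[i] x)
    exact ⟨by linarith [hy.1], by linarith [hy.2]⟩
  have hdisj : (↑(Finset.range (qden ρ (n + 1))) : Set ℕ).PairwiseDisjoint A := by
    intro i hi j hj hij
    refine Set.disjoint_left.2 fun y h1 h2 => hij ?_
    rw [hA] at h1 h2
    exact (H.eq_of_mem_Ico hρ h01 n (Finset.mem_range.1 hi) (Finset.mem_range.1 hj) h1 h2).1
  have hvol := MeasureTheory.measure_biUnion_finset (μ := MeasureTheory.volume) hdisj
    (fun i _ => by rw [hA]; exact measurableSet_Ico)
  have hle2 : MeasureTheory.volume (⋃ i ∈ Finset.range (qden ρ (n + 1)), A i) ≤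
      ENNReal.ofReal 2 := by
    refine (MeasureTheory.measure_mono (iUnion₂_subset fun i _ => hsub i)).trans ?_
    rw [Real.volume_Ico]
    norm_num
  have hpos : ∀ i : ℕ, 0 ≤ f^[i] (act (gam ρ n) x) - f^[i] x := fun i => by
    rw [← H.nat, ← H.nat]
    exact sub_nonneg.2 ((H.strictMono _).monotone hle)
  rw [hvol] at hle2
  simp only [hA, Real.volume_Ico, hlen] at hle2
  rw [← ENNReal.ofReal_sum_of_nonneg (fun i _ => hpos i)] at hle2
  exact (ENNReal.ofReal_le_ofReal_iff (by norm_num)).1 hle2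

lemma sum_weight_le (H : IsRotAction f ρ act) (hρ : Irrational ρ) (h01 : ρ ∈ Ioo (0 : ℝ) 1)
    (X : Finset ℝ) (n : ℕ) (x : ℝ) :
    ∑ i ∈ Finset.range (qden ρ (n + 1)), weight X (f^[i] x) (f^[i] (act (gam ρ n) x)) ≤
      2 + X.card := by
  simp only [weight]
  rw [Finset.sum_add_distrib, Finset.sum_comm]
  refine add_le_add (H.sum_length_le hρ h01 n x) ?_
  have : ∀ s ∈ X, ∑ i ∈ Finset.range (qden ρ (n + 1)),
      indicator {s : ℝ | ∃ m : ℤ, s + m ∈ Ico (f^[i] x) (f^[i] (act (gam ρ n) x))}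
        (fun _ => (1 : ℝ)) s ≤ 1 := by
    intro s _
    by_cases hex : ∃ i ∈ Finset.range (qden ρ (n + 1)),
        ∃ m : ℤ, s + m ∈ Ico (f^[i] x) (f^[i] (act (gam ρ n) x))
    · obtain ⟨i, hi, m, hm⟩ := hex
      rw [Finset.sum_eq_single_of_mem i hi]
      · exact indicator_le_self' (fun _ _ => zero_le_one) s
      · intro j hj hji
        refine indicator_of_notMem ?_ _
        rintro ⟨m', hm'⟩
        refine hji (H.eq_of_mem_Ico hρ h01 n (m := -m') (m' := -m) (x := x) (y := s)
          (Finset.mem_range.1 hj) (Finset.mem_range.1 hi) ?_ ?_).1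
        · rw [H.int _ _ x, H.int _ _ (act _ _), H.nat, H.nat]
          push_cast
          exact ⟨by linarith [hm'.1], by linarith [hm'.2]⟩
        · rw [H.int _ _ x, H.int _ _ (act _ _), H.nat, H.nat]
          push_cast
          exact ⟨by linarith [hm.1], by linarith [hm.2]⟩
    · push Not at hex
      rw [Finset.sum_eq_zero]
      · exact zero_le_one
      · intro i hi
        refine indicator_of_notMem ?_ _
        rintro ⟨m, hm⟩
        exact hex i hi m hm
  refine (Finset.sum_le_sum this).trans ?_
  simp

/-- Bounded multiplicity of the first `S q_{n+1}` images of `N` consecutive return arcs. -/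
lemma sum_weight_smul_le (H : IsRotAction f ρ act) (hρ : Irrational ρ) (h01 : ρ ∈ Ioo (0 : ℝ) 1)
    (X : Finset ℝ) (n N S : ℕ) {k : ℕ} (hk : k ≤ S * qden ρ (n + 1)) (x : ℝ) :
    ∑ i ∈ Finset.range k, weight X (f^[i] x) (f^[i] (act ((N : ℤ) • gam ρ n) x)) ≤
      S * (N * (2 + X.card)) := by
  have hN : ∀ x, ∑ i ∈ Finset.range (qden ρ (n + 1)),
      weight X (f^[i] x) (f^[i] (act ((N : ℤ) • gam ρ n) x)) ≤ N * (2 + X.card) := by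
    intro x
    induction N with
    | zero => simp [H.zero, weight]
    | succ N ih =>
      have h1 : act (((N + 1 : ℕ) : ℤ) • gam ρ n) x =
          act (gam ρ n) (act ((N : ℤ) • gam ρ n) x) := by
        rw [← H.add, add_comm (gam ρ n)]
        push_cast
        rw [_root_.add_smul, one_smul]
      have h2 := H.sum_weight_le hρ h01 X n (act ((N : ℤ) • gam ρ n) x)
      rw [h1]
      refine (Finset.sum_le_sum fun i _ =>
        weight_le_add X (b := f^[i] (act ((N : ℤ) • gam ρ n) x))).trans ?_
      rw [Finset.sum_add_distrib]
      push_cast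
      linarith
  have hnn : ∀ i, 0 ≤ weight X (f^[i] x) (f^[i] (act ((N : ℤ) • gam ρ n) x)) := fun i => by
    refine weight_nonneg X ?_
    rw [← H.nat, ← H.nat]
    refine (H.strictMono _).monotone ?_
    have := H.smul_le hρ h01 n (Int.natCast_nonneg N) x
    rwa [zero_smul, H.zero] at this
  refine (Finset.sum_le_sum_of_subset_of_nonneg (Finset.range_mono hk) fun i _ _ => hnn i).trans ?_
  clear hk hnn
  induction S with
  | zero => simp
  | succ S ih =>
    rw [add_mul, one_mul, Finset.sum_range_add]
    have h1 := hN (f^[S * qden ρ (n + 1)] x)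
    have h2 : ∀ i, f^[S * qden ρ (n + 1) + i] (act ((N : ℤ) • gam ρ n) x) =
        f^[i] (act ((N : ℤ) • gam ρ n) (f^[S * qden ρ (n + 1)] x)) := fun i => by
      rw [add_comm, Function.iterate_add_apply, ← H.nat (S * qden ρ (n + 1)),
        ← H.nat (S * qden ρ (n + 1)), H.comm]
    have h3 : ∀ i, f^[S * qden ρ (n + 1) + i] x = f^[i] (f^[S * qden ρ (n + 1)] x) := fun i => by
      rw [add_comm, Function.iterate_add_apply]
    simp only [h2, h3]
    push_cast
    linarith

end IsRotAction

lemma crossRatio_le_of_ratio {g : ℝ → ℝ} {a b c d K L : ℝ} (hab : a < b) (hbc : b < c)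
    (hcd : c < d) (gab : g a < g b) (gbc : g b < g c) (gcd : g c < g d) (hK : 0 ≤ K)
    (h1 : (g b - g a) * (c - a) ≤ K * ((b - a) * (g c - g a)))
    (h2 : (g d - g c) * (d - b) ≤ L * ((d - c) * (g d - g b))) :
    crossRatio (g a) (g b) (g c) (g d) ≤ K * L * crossRatio a b c d := by
  have p1 : 0 < c - a := by linarith
  have p2 : 0 < d - b := by linarith
  have p3 : 0 < g c - g a := by linarith
  have p4 : 0 < g d - g b := by linarith
  have e1 : (g b - g a) / (g c - g a) ≤ K * ((b - a) / (c - a)) := by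
    rw [← mul_div_assoc, div_le_div_iff₀ p3 p1]
    linarith
  have e2 : (g d - g c) / (g d - g b) ≤ L * ((d - c) / (d - b)) := by
    rw [← mul_div_assoc, div_le_div_iff₀ p4 p2]
    linarith
  have := mul_le_mul e1 e2 (div_nonneg (by linarith) p4.le)
    (mul_nonneg hK (div_nonneg (by linarith) p1.le))
  calc crossRatio (g a) (g b) (g c) (g d)
      = (g b - g a) / (g c - g a) * ((g d - g c) / (g d - g b)) := by
        rw [crossRatio, div_mul_div_comm]
    _ ≤ _ := this
    _ = K * L * crossRatio a b c d := by
        rw [crossRatio, ← div_mul_div_comm]; ring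

lemma sinh_mul_le {p : ℝ} (hp : 1 ≤ p) {u v : ℝ} (hu : 0 < u) (huv : u ≤ v) :
    Real.sinh (p * u) * Real.sinh v ≤ Real.sinh (p * v) * Real.sinh u := by
  have hsinh : ∀ q t : ℝ, HasDerivAt (fun t => Real.sinh (q * t)) (q * Real.cosh (q * t)) t := by
    intro q t
    have := (Real.hasDerivAt_sinh (q * t)).comp t ((hasDerivAt_id t).const_mul q)
    simpa [mul_comm, Function.comp_def] using this
  have hcosh : ∀ q t : ℝ, HasDerivAt (fun t => Real.cosh (q * t)) (q * Real.sinh (q * t)) t := by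
    intro q t
    have := (Real.hasDerivAt_cosh (q * t)).comp t ((hasDerivAt_id t).const_mul q)
    simpa [mul_comm, Function.comp_def] using this
  have hE : ∀ t, 0 ≤ t → 0 ≤ p * Real.cosh (p * t) * Real.sinh t -
      Real.sinh (p * t) * Real.cosh t := by
    have hd : ∀ t, HasDerivAt (fun t => p * Real.cosh (p * t) * Real.sinh t -
        Real.sinh (p * t) * Real.cosh t) ((p ^ 2 - 1) * (Real.sinh (p * t) * Real.sinh t)) t := by
      intro t
      have := (((hcosh p t).const_mul p).mul (Real.hasDerivAt_sinh t)).sub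
        ((hsinh p t).mul (Real.hasDerivAt_cosh t))
      exact this.congr_deriv (by ring)
    have hm : MonotoneOn (fun t => p * Real.cosh (p * t) * Real.sinh t -
        Real.sinh (p * t) * Real.cosh t) (Ici 0) := by
      refine monotoneOn_of_deriv_nonneg (convex_Ici 0)
        (fun t _ => (hd t).continuousAt.continuousWithinAt)
        (fun t _ => (hd t).differentiableAt.differentiableWithinAt) ?_
      intro t ht
      rw [interior_Ici, mem_Ioi] at ht
      rw [(hd t).deriv]
      have h1 := Real.sinh_nonneg_iff.2 ht.le
      have h2 := Real.sinh_nonneg_iff.2 (mul_nonneg (by linarith) ht.le : 0 ≤ p * t)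
      have h3 : 0 ≤ p ^ 2 - 1 := by nlinarith
      positivity
    intro t ht
    have := hm (mem_Ici.2 le_rfl) (mem_Ici.2 ht) ht
    simpa using this
  have hm : MonotoneOn (fun t => Real.sinh (p * t) / Real.sinh t) (Ioi 0) := by
    have hd : ∀ t, 0 < t → HasDerivAt (fun t => Real.sinh (p * t) / Real.sinh t)
        ((p * Real.cosh (p * t) * Real.sinh t - Real.sinh (p * t) * Real.cosh t) /
          Real.sinh t ^ 2) t :=
      fun t ht => (hsinh p t).div (Real.hasDerivAt_sinh t) (Real.sinh_pos_iff.2 ht).ne'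
    refine monotoneOn_of_deriv_nonneg (convex_Ioi 0)
      (fun t ht => (hd t ht).continuousAt.continuousWithinAt)
      (fun t ht => (hd t (interior_subset ht)).differentiableAt.differentiableWithinAt) ?_
    intro t ht
    rw [interior_Ioi, mem_Ioi] at ht
    rw [(hd t ht).deriv]
    exact div_nonneg (hE t ht.le) (sq_nonneg _)
  have h := hm (mem_Ioi.2 hu) (mem_Ioi.2 (hu.trans_le huv)) huv
  exact (div_le_div_iff₀ (Real.sinh_pos_iff.2 hu) (Real.sinh_pos_iff.2 (hu.trans_le huv))).1 h

lemma crossRatio_rpow_le {p : ℝ} (hp : 1 ≤ p) {a b c d : ℝ} (ha : 0 < a) (hab : a < b)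
    (hbc : b < c) (hcd : c < d) :
    crossRatio (a ^ p) (b ^ p) (c ^ p) (d ^ p) ≤ crossRatio a b c d := by
  have hb := ha.trans hab
  have hc := hb.trans hbc
  have hd := hc.trans hcd
  obtain ⟨α, rfl⟩ : ∃ α, a = Real.exp (2 * α) :=
    ⟨Real.log a / 2, by rw [mul_div_cancel₀ _ two_ne_zero, Real.exp_log ha]⟩
  obtain ⟨β, rfl⟩ : ∃ α, b = Real.exp (2 * α) :=
    ⟨Real.log b / 2, by rw [mul_div_cancel₀ _ two_ne_zero, Real.exp_log hb]⟩
  obtain ⟨γ, rfl⟩ : ∃ α, c = Real.exp (2 * α) :=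
    ⟨Real.log c / 2, by rw [mul_div_cancel₀ _ two_ne_zero, Real.exp_log hc]⟩
  obtain ⟨δ, rfl⟩ : ∃ α, d = Real.exp (2 * α) :=
    ⟨Real.log d / 2, by rw [mul_div_cancel₀ _ two_ne_zero, Real.exp_log hd]⟩
  rw [Real.exp_lt_exp] at hab hbc hcd
  have hdiff : ∀ s t : ℝ, Real.exp t - Real.exp s =
      2 * Real.exp ((s + t) / 2) * Real.sinh ((t - s) / 2) := by
    intro s t
    rw [Real.sinh_eq, mul_comm 2, mul_assoc, mul_div_cancel₀ _ two_ne_zero, mul_sub,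
      ← Real.exp_add, ← Real.exp_add]
    congr 2 <;> ring
  have hpow : ∀ s : ℝ, Real.exp (2 * s) ^ p = Real.exp (2 * (p * s)) := by
    intro s
    rw [← Real.exp_mul]
    ring_nf
  have key : ∀ s t u v : ℝ, crossRatio (Real.exp (2 * s)) (Real.exp (2 * t)) (Real.exp (2 * u))
      (Real.exp (2 * v)) = Real.sinh (t - s) / Real.sinh (u - s) *
        (Real.sinh (v - u) / Real.sinh (v - t)) := by
    intro s t u v
    rw [crossRatio, hdiff, hdiff, hdiff, hdiff]
    have e : ∀ x y : ℝ, (2 * x - 2 * y) / 2 = x - y := fun x y => by ring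
    have e2 : ∀ x y : ℝ, (2 * x + 2 * y) / 2 = x + y := fun x y => by ring
    simp only [e, e2]
    rw [div_mul_div_comm]
    have : Real.exp (s + t) * Real.exp (u + v) = Real.exp (s + u) * Real.exp (t + v) := by
      rw [← Real.exp_add, ← Real.exp_add]; ring_nf
    rw [show 2 * Real.exp (s + t) * Real.sinh (t - s) * (2 * Real.exp (u + v) * Real.sinh (v - u))
      = (4 * (Real.exp (s + t) * Real.exp (u + v))) * (Real.sinh (t - s) * Real.sinh (v - u)) by
        ring,
      show 2 * Real.exp (s + u) * Real.sinh (u - s) * (2 * Real.exp (t + v) * Real.sinh (v - t))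
      = (4 * (Real.exp (s + t) * Real.exp (u + v))) * (Real.sinh (u - s) * Real.sinh (v - t)) by
        rw [this]; ring]
    exact mul_div_mul_left _ _ (by positivity)
  have hfac : ∀ u v : ℝ, 0 < u → u < v →
      Real.sinh (p * u) / Real.sinh (p * v) ≤ Real.sinh u / Real.sinh v := by
    intro u v hu huv
    have hpv : 0 < p * v := mul_pos (by linarith) (hu.trans huv)
    rw [div_le_div_iff₀ (Real.sinh_pos_iff.2 hpv) (Real.sinh_pos_iff.2 (hu.trans huv))]
    linarith [sinh_mul_le hp hu huv.le]
  have hnn : ∀ u v : ℝ, 0 < u → u < v → 0 ≤ Real.sinh u / Real.sinh v := fun u v hu huv =>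
    div_nonneg (Real.sinh_nonneg_iff.2 hu.le) (Real.sinh_nonneg_iff.2 (hu.trans huv).le)
  rw [hpow, hpow, hpow, hpow, key, key]
  simp only [← mul_sub]
  have h0 : 0 < p := by linarith
  refine mul_le_mul (hfac _ _ (by linarith) (by linarith)) (hfac _ _ (by linarith) (by linarith))
    (hnn _ _ (mul_pos h0 (by linarith)) ?_) (hnn _ _ (by linarith) (by linarith))
  exact mul_lt_mul_of_pos_left (by linarith) h0

/-- The odd power law `u ↦ u |u|^{p-1}`. -/
def oddPow (p u : ℝ) : ℝ := u * |u| ^ (p - 1)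

lemma oddPow_neg (p u : ℝ) : oddPow p (-u) = -oddPow p u := by
  simp [oddPow]

lemma oddPow_of_pos (p : ℝ) {u : ℝ} (hu : 0 < u) : oddPow p u = u ^ p := by
  rw [oddPow, abs_of_pos hu, Real.rpow_sub_one hu.ne', mul_div_cancel₀ _ hu.ne']

lemma oddPow_nonneg (p : ℝ) {u : ℝ} (hu : 0 ≤ u) : 0 ≤ oddPow p u :=
  mul_nonneg hu (Real.rpow_nonneg (abs_nonneg u) _)

lemma oddPow_le {p s u : ℝ} (hp : 1 ≤ p) (hu : 0 ≤ u) (hs : u ≤ s) :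
    oddPow p u ≤ s ^ (p - 1) * u := by
  rw [oddPow, abs_of_nonneg hu, mul_comm]
  exact mul_le_mul_of_nonneg_right (Real.rpow_le_rpow hu hs (by linarith)) hu

lemma oddPow_self {p s : ℝ} (hs : 0 ≤ s) : oddPow p s = s ^ (p - 1) * s := by
  rw [oddPow, abs_of_nonneg hs, mul_comm]

lemma oddPow_sub_le {p s u v : ℝ} (hp : 1 ≤ p) (huv : u < v) (hu : |u| ≤ s) (hv : |v| ≤ s) :
    oddPow p v - oddPow p u ≤ p * s ^ (p - 1) * (v - u) := by
  have hs : 0 ≤ s := (abs_nonneg u).trans hu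
  have hS : 0 ≤ s ^ (p - 1) := Real.rpow_nonneg hs _
  have pos : ∀ a b : ℝ, 0 ≤ a → a < b → b ≤ s →
      oddPow p b - oddPow p a ≤ p * s ^ (p - 1) * (b - a) := by
    intro a b ha hab hb
    have hb0 : 0 < b := ha.trans_lt hab
    have h1 := one_add_mul_self_le_rpow_one_add (s := a / b - 1) (by
      have := div_nonneg ha hb0.le
      linarith) hp
    rw [add_sub_cancel, Real.div_rpow ha hb0.le, le_div_iff₀ (Real.rpow_pos_of_pos hb0 p)] at h1
    have h2 : b ^ p = b ^ (p - 1) * b := by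
      rw [← oddPow_of_pos p hb0, oddPow_self hb0.le]
    have h3 : oddPow p a = a ^ p := by
      rcases ha.eq_or_lt with h | h
      · rw [← h, Real.zero_rpow (by linarith), oddPow, zero_mul]
      · exact oddPow_of_pos p h
    have h4 : (1 + p * (a / b - 1)) * b ^ p = b ^ p + p * b ^ (p - 1) * (a - b) := by
      rw [h2]; field_simp
    have h5 : b ^ (p - 1) ≤ s ^ (p - 1) := Real.rpow_le_rpow hb0.le hb (by linarith)
    rw [oddPow_of_pos p hb0, h3]
    rw [h4] at h1
    have h6 : p * b ^ (p - 1) * (b - a) ≤ p * s ^ (p - 1) * (b - a) :=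
      mul_le_mul_of_nonneg_right (mul_le_mul_of_nonneg_left h5 (by linarith)) (by linarith)
    linarith
  rw [abs_le] at hu hv
  rcases le_or_gt 0 u with h0 | h0
  · exact pos u v h0 huv hv.2
  · rcases le_or_gt v 0 with h1 | h1
    · have := pos (-v) (-u) (by linarith) (by linarith) (by linarith)
      rw [oddPow_neg, oddPow_neg] at this
      linarith
    · have e1 := oddPow_le hp h1.le hv.2
      have e2 := oddPow_le hp (u := -u) (s := s) (by linarith) (by linarith)
      rw [oddPow_neg] at e2
      nlinarith [mul_nonneg (mul_nonneg (sub_nonneg.2 hp) hS) (sub_nonneg.2 huv.le)]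

lemma le_oddPow_sub {p s u v : ℝ} (hp : 1 ≤ p) (huv : u < v) (hs : s = max |u| |v|) :
    s ^ (p - 1) / 2 * (v - u) ≤ oddPow p v - oddPow p u := by
  have pos : ∀ a b : ℝ, a < b → |a| ≤ b →
      b ^ (p - 1) / 2 * (b - a) ≤ oddPow p b - oddPow p a := by
    intro a b hab hb
    have hb0 : 0 ≤ b := (abs_nonneg a).trans hb
    have hS : 0 ≤ b ^ (p - 1) := Real.rpow_nonneg hb0 _
    rw [oddPow_self hb0]
    rw [abs_le] at hb
    rcases le_or_gt 0 a with h0 | h0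
    · have := oddPow_le hp h0 hb.2
      nlinarith
    · have := oddPow_nonneg p (u := -a) (by linarith)
      rw [oddPow_neg] at this
      nlinarith
  rcases le_total |u| |v| with h | h
  · rw [max_eq_right h] at hs
    rcases le_or_gt 0 v with h0 | h0
    · rw [abs_of_nonneg h0] at hs h
      rw [hs]
      exact pos u v huv h
    · exfalso
      rw [abs_of_neg h0, abs_of_neg (huv.trans h0)] at h
      linarith
  · rw [max_eq_left h] at hs
    rcases le_or_gt 0 u with h0 | h0
    · exfalso
      rw [abs_of_nonneg h0, abs_of_nonneg (h0.trans huv.le)] at h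
      linarith
    · rw [abs_of_neg h0] at hs h
      have := pos (-v) (-u) (by linarith) (by rwa [abs_neg])
      rw [oddPow_neg, oddPow_neg] at this
      rw [hs]
      linarith

lemma oddPow_ratio {p u u' v' v : ℝ} (hp : 1 ≤ p) (h1 : u ≤ u') (h2 : u' < v') (h3 : v' ≤ v) :
    (oddPow p v' - oddPow p u') * (v - u) ≤
      2 * p * ((v' - u') * (oddPow p v - oddPow p u)) := by
  have hu' : |u'| ≤ max |u| |v| := abs_le_max_abs_abs h1 (h2.le.trans h3)
  have hv' : |v'| ≤ max |u| |v| := abs_le_max_abs_abs (h1.trans h2.le) h3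
  have e1 := oddPow_sub_le hp h2 hu' hv'
  have e2 := le_oddPow_sub hp (h1.trans_lt (h2.trans_le h3)) rfl
  calc (oddPow p v' - oddPow p u') * (v - u)
      ≤ p * max |u| |v| ^ (p - 1) * (v' - u') * (v - u) :=
        mul_le_mul_of_nonneg_right e1 (by linarith)
    _ = 2 * p * ((v' - u') * (max |u| |v| ^ (p - 1) / 2 * (v - u))) := by ring
    _ ≤ _ := mul_le_mul_of_nonneg_left (mul_le_mul_of_nonneg_left e2 (by linarith)) (by linarith)

lemma crossRatio_oddPow_le {p a b c d : ℝ} (hp : 1 ≤ p) (hab : a < b) (hbc : b < c) (hcd : c < d)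
    (h0 : 0 < a ∨ d < 0) :
    crossRatio (oddPow p a) (oddPow p b) (oddPow p c) (oddPow p d) ≤ crossRatio a b c d := by
  rcases h0 with h0 | h0
  · rw [oddPow_of_pos p h0, oddPow_of_pos p (by linarith), oddPow_of_pos p (by linarith),
      oddPow_of_pos p (by linarith)]
    exact crossRatio_rpow_le hp h0 hab hbc hcd
  · have hsymm : ∀ x y z w : ℝ, crossRatio (-w) (-z) (-y) (-x) = crossRatio x y z w := by
      intro x y z w
      simp only [crossRatio]
      congr 1 <;> ring
    have := crossRatio_rpow_le hp (a := -d) (b := -c) (c := -b) (d := -a) (by linarith)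
      (by linarith) (by linarith) (by linarith)
    rw [← oddPow_of_pos p (by linarith), ← oddPow_of_pos p (by linarith),
      ← oddPow_of_pos p (by linarith), ← oddPow_of_pos p (by linarith),
      oddPow_neg, oddPow_neg, oddPow_neg, oddPow_neg, hsymm, hsymm] at this
    exact this

lemma contDiffAt_deriv {g : ℝ → ℝ} {x : ℝ} {m n : WithTop ℕ∞} (h : ContDiffAt ℝ n g x)
    (hmn : m + 1 ≤ n) : ContDiffAt ℝ m (deriv g) x :=
  (h.fderiv_right hmn).clm_apply contDiffAt_const

/-- Near a regular point of a `C²` map the ratio distortion is controlled by length. -/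
lemma exists_ratio_of_deriv_pos {g : ℝ → ℝ} {x : ℝ} (hg : ContDiffAt ℝ 2 g x)
    (hx : 0 < deriv g x) :
    ∃ r K : ℝ, 0 < r ∧ 0 ≤ K ∧ StrictMonoOn g (Ioo (x - r) (x + r)) ∧
      ∀ u u' v' v, x - r < u → u ≤ u' → u' < v' → v' ≤ v → v < x + r →
        (g v' - g u') * (v - u) ≤ Real.exp (K * (v - u)) * ((v' - u') * (g v - g u)) := by
  have hd1 : ContDiffAt ℝ 1 (deriv g) x := contDiffAt_deriv hg (by norm_num)
  obtain ⟨K, t, ht, hK⟩ := hd1.exists_lipschitzOnWith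
  have hev : ∀ᶠ y in 𝓝 x, y ∈ t ∧ deriv g x / 2 < deriv g y :=
    (eventually_mem_set.2 ht).and (hd1.continuousAt.eventually (lt_mem_nhds (by linarith)))
  obtain ⟨r, hr, hball⟩ := Metric.eventually_nhds_iff_ball.1 hev
  rw [Real.ball_eq_Ioo] at hball
  have hdiff : ∀ y ∈ Ioo (x - r) (x + r), DifferentiableAt ℝ g y := by
    intro y hy
    refine differentiableAt_of_deriv_ne_zero ?_
    linarith [(hball y hy).2]
  have hmvt : ∀ u v, x - r < u → u < v → v < x + r →
      ∃ ξ ∈ Ioo u v, g v - g u = deriv g ξ * (v - u) := by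
    intro u v hu huv hv
    obtain ⟨ξ, hξ, h⟩ := exists_deriv_eq_slope g huv
      (fun y hy =>
        (hdiff y ⟨by linarith [hy.1], by linarith [hy.2]⟩).continuousAt.continuousWithinAt)
      (fun y hy => (hdiff y ⟨by linarith [hy.1], by linarith [hy.2]⟩).differentiableWithinAt)
    refine ⟨ξ, hξ, ?_⟩
    rw [h, div_mul_cancel₀ _ (sub_pos.2 huv).ne']
  refine ⟨r, K / (deriv g x / 2), hr, by positivity, ?_, ?_⟩
  · intro u hu v hv huv
    obtain ⟨ξ, hξ, h⟩ := hmvt u v hu.1 huv hv.2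
    have h1 := (hball ξ ⟨by linarith [hξ.1, hu.1], by linarith [hξ.2, hv.2]⟩).2
    have : 0 < deriv g ξ * (v - u) := mul_pos (by linarith) (by linarith)
    linarith
  · intro u u' v' v h1 h2 h3 h4 h5
    obtain ⟨ξ, hξ, e1⟩ := hmvt u' v' (by linarith) h3 (by linarith)
    obtain ⟨η, hη, e2⟩ := hmvt u v h1 (by linarith) h5
    have hξ' : ξ ∈ Ioo (x - r) (x + r) := ⟨by linarith [hξ.1], by linarith [hξ.2]⟩
    have hη' : η ∈ Ioo (x - r) (x + r) := ⟨by linarith [hη.1], by linarith [hη.2]⟩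
    have h6 : deriv g ξ ≤ deriv g η + K * (v - u) := by
      have := hK.dist_le_mul ξ (hball ξ hξ').1 η (hball η hη').1
      rw [Real.dist_eq, Real.dist_eq] at this
      have h7 : |ξ - η| ≤ v - u := by
        rw [abs_le]
        exact ⟨by linarith [hξ.1, hη.2], by linarith [hξ.2, hη.1]⟩
      have h8 := mul_le_mul_of_nonneg_left h7 K.coe_nonneg
      linarith [le_abs_self (deriv g ξ - deriv g η)]
    have h9 : deriv g ξ ≤ Real.exp (K / (deriv g x / 2) * (v - u)) * deriv g η := by
      have h10 := Real.add_one_le_exp (K / (deriv g x / 2) * (v - u))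
      have h11 := (hball η hη').2
      have h12 : (K : ℝ) * (v - u) = K / (deriv g x / 2) * (v - u) * (deriv g x / 2) := by
        field_simp
      have h13 : 0 ≤ K / (deriv g x / 2) * (v - u) :=
        mul_nonneg (by positivity) (by linarith)
      nlinarith
    rw [e1, e2]
    calc deriv g ξ * (v' - u') * (v - u) = deriv g ξ * ((v' - u') * (v - u)) := by ring
      _ ≤ Real.exp (K / (deriv g x / 2) * (v - u)) * deriv g η * ((v' - u') * (v - u)) :=
        mul_le_mul_of_nonneg_right h9 (mul_nonneg (by linarith) (by linarith))
      _ = _ := by ring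

/-- Near `x`, ratio distortion is bounded by `exp K`, and the cross-ratio distortion on arcs that
avoid `x` is bounded by `exp (K * length)`. -/
def LocalDistortion (f : ℝ → ℝ) (x r K : ℝ) : Prop :=
  0 < r ∧ 0 ≤ K ∧
    (∀ u u' v' v, x - r < u → u ≤ u' → u' < v' → v' ≤ v → v < x + r →
      (f v' - f u') * (v - u) ≤ Real.exp K * ((v' - u') * (f v - f u))) ∧
    ∀ a b c d, x - r < a → a < b → b < c → c < d → d < x + r → x ∉ Icc a d →
      crossRatio (f a) (f b) (f c) (f d) ≤ Real.exp (K * (d - a)) * crossRatio a b c d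

lemma crossRatio_nonneg {a b c d : ℝ} (hab : a ≤ b) (hbc : b ≤ c) (hcd : c ≤ d) :
    0 ≤ crossRatio a b c d :=
  div_nonneg (mul_nonneg (by linarith) (by linarith)) (mul_nonneg (by linarith) (by linarith))

lemma crossRatio_le_exp_of_ratio {g : ℝ → ℝ} {x r K : ℝ} (hK : 0 ≤ K)
    (hmono : StrictMonoOn g (Ioo (x - r) (x + r)))
    (h : ∀ u u' v' v, x - r < u → u ≤ u' → u' < v' → v' ≤ v → v < x + r →
        (g v' - g u') * (v - u) ≤ Real.exp (K * (v - u)) * ((v' - u') * (g v - g u)))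
    {a b c d : ℝ} (ha : x - r < a) (hab : a < b) (hbc : b < c) (hcd : c < d) (hd : d < x + r) :
    crossRatio (g a) (g b) (g c) (g d) ≤ Real.exp (2 * K * (d - a)) * crossRatio a b c d := by
  have m1 : g a < g b := hmono ⟨by linarith, by linarith⟩ ⟨by linarith, by linarith⟩ hab
  have m2 : g b < g c := hmono ⟨by linarith, by linarith⟩ ⟨by linarith, by linarith⟩ hbc
  have m3 : g c < g d := hmono ⟨by linarith, by linarith⟩ ⟨by linarith, by linarith⟩ hcd
  refine (crossRatio_le_of_ratio hab hbc hcd m1 m2 m3 (Real.exp_pos _).le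
    (h a a b c ha le_rfl hab hbc.le (by linarith))
    (h b c d d (by linarith) hbc.le hcd le_rfl hd)).trans ?_
  rw [← Real.exp_add]
  refine mul_le_mul_of_nonneg_right (Real.exp_le_exp.2 ?_)
    (crossRatio_nonneg hab.le hbc.le hcd.le)
  nlinarith

lemma localDistortion_of_deriv_pos {g : ℝ → ℝ} {x : ℝ} (hg : ContDiffAt ℝ 2 g x)
    (hx : 0 < deriv g x) : ∃ r K, LocalDistortion g x r K := by
  obtain ⟨r, K, hr, hK, hmono, h⟩ := exists_ratio_of_deriv_pos hg hx
  have hsub : Ioo (x - min r (1 / 2)) (x + min r (1 / 2)) ⊆ Ioo (x - r) (x + r) :=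
    Ioo_subset_Ioo (by linarith [min_le_left r (1 / 2)]) (by linarith [min_le_left r (1 / 2)])
  have hmin := min_le_left r (1 / 2)
  have hmin' := min_le_right r (1 / 2)
  refine ⟨min r (1 / 2), 2 * K, lt_min hr (by norm_num), by linarith, ?_, ?_⟩
  · intro u u' v' v h1 h2 h3 h4 h5
    refine (h u u' v' v (by linarith) h2 h3 h4 (by linarith)).trans ?_
    have m : g u ≤ g v := (hmono ⟨by linarith, by linarith⟩ ⟨by linarith, by linarith⟩
      (by linarith : u < v)).le
    refine mul_le_mul_of_nonneg_right (Real.exp_le_exp.2 ?_)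
      (mul_nonneg (by linarith) (by linarith))
    nlinarith
  · intro a b c d h1 h2 h3 h4 h5 _
    exact crossRatio_le_exp_of_ratio hK hmono h (by linarith) h2 h3 h4 (by linarith)

lemma IsNonFlatCritPt.translate {f : ℝ → ℝ} {c d : ℝ} (h : IsNonFlatCritPt f c d) {k : ℝ}
    (hk : ∀ x, f (x + k) = f x + k) : IsNonFlatCritPt f (c + k) d := by
  obtain ⟨hd, W, φ, hW, hc, hφ, h0, hne, hinj, heq⟩ := h
  refine ⟨hd, (fun x => x - k) ⁻¹' W, fun x => φ (x - k),
    hW.preimage (continuous_id.sub continuous_const), by simpa using hc, ?_, by simpa using h0,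
    ?_, ?_, ?_⟩
  · exact hφ.comp (contDiff_id.sub contDiff_const).contDiffOn fun x hx => hx
  · intro x hx
    rw [deriv_comp_sub_const]
    exact hne _ hx
  · intro x hx y hy hxy
    have := hinj hx hy hxy
    linarith
  · intro x hx
    have h1 := heq _ hx
    have h2 := hk (x - k)
    rw [sub_add_cancel] at h2
    rw [h2, h1, hk]
    ring

/-- Normal form at a non-flat critical point of an increasing map. -/
lemma IsNonFlatCritPt.exists_normalForm {f : ℝ → ℝ} {c d : ℝ} (h : IsNonFlatCritPt f c d)
    (hf : StrictMono f) : 1 < d ∧ ∃ φ : ℝ → ℝ, ContDiffAt ℝ 3 φ c ∧ φ c = 0 ∧ 0 < deriv φ c ∧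
      ∀ᶠ x in 𝓝 c, f x = f c + oddPow d (φ x) := by
  obtain ⟨hd, W, φ, hW, hc, hφ, h0, hne, hinj, heq⟩ := h
  have hWn := hW.mem_nhds hc
  have hφc := hφ.contDiffAt hWn
  refine ⟨hd, φ, hφc, h0, ?_, by filter_upwards [hWn] with x hx using heq x hx⟩
  by_contra hcon
  have hneg : deriv φ c < 0 := lt_of_le_of_ne (not_lt.1 hcon) (hne c hc)
  have hneg' : 0 < deriv (fun x => -φ x) c := by
    have : deriv (fun x => -φ x) c = -deriv φ c := deriv.fun_neg
    rw [this]
    linarith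
  obtain ⟨r, K, hr, -, hmono, -⟩ := exists_ratio_of_deriv_pos
    ((hφc.neg).of_le (by norm_num) : ContDiffAt ℝ 2 (fun x => -φ x) c) hneg'
  obtain ⟨s, hs, hball⟩ := Metric.mem_nhds_iff.1 hWn
  rw [Real.ball_eq_Ioo] at hball
  have hm : 0 < min r s := lt_min hr hs
  have h1 := min_le_left r s
  have h2 := min_le_right r s
  have e1 := heq (c + min r s / 2) (hball ⟨by linarith, by linarith⟩)
  have e2 : -φ c < -φ (c + min r s / 2) := hmono ⟨by linarith, by linarith⟩
    ⟨by linarith, by linarith⟩ (by linarith)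
  have e3 : f c < f (c + min r s / 2) := hf (by linarith)
  have e4 := oddPow_nonneg d (u := -φ (c + min r s / 2)) (by linarith)
  rw [oddPow_neg, oddPow] at e4
  linarith

lemma localDistortion_of_isNonFlatCritPt {f : ℝ → ℝ} {c d : ℝ} (h : IsNonFlatCritPt f c d)
    (hf : StrictMono f) : ∃ r K, LocalDistortion f c r K := by
  obtain ⟨hd, φ, hφ, h0, hpos, hev⟩ := h.exists_normalForm hf
  obtain ⟨r, K, hr, hK, hmono, hrat⟩ := exists_ratio_of_deriv_pos (hφ.of_le (by norm_num)) hpos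
  obtain ⟨s, hs, hball⟩ := Metric.eventually_nhds_iff_ball.1 hev
  rw [Real.ball_eq_Ioo] at hball
  obtain ⟨t, ht⟩ : ∃ t, t = min (min r s) (1 / 2) := ⟨_, rfl⟩
  have ht0 : 0 < t := by rw [ht]; exact lt_min (lt_min hr hs) (by norm_num)
  have ht1 : t ≤ r := by rw [ht]; exact (min_le_left _ _).trans (min_le_left _ _)
  have ht2 : t ≤ s := by rw [ht]; exact (min_le_left _ _).trans (min_le_right _ _)
  have ht3 : t ≤ 1 / 2 := by rw [ht]; exact min_le_right _ _
  have hfeq : ∀ x, c - t < x → x < c + t → f x = f c + oddPow d (φ x) := fun x h1 h2 =>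
    hball x ⟨by linarith, by linarith⟩
  have hm : ∀ x y, c - t < x → x < y → y < c + t → φ x < φ y := fun x y h1 h2 h3 =>
    hmono ⟨by linarith, by linarith⟩ ⟨by linarith, by linarith⟩ h2
  refine ⟨t, 2 * d + 2 * K, ht0, by linarith, ?_, ?_⟩
  · intro u u' v' v h1 h2 h3 h4 h5
    have e1 := hrat u u' v' v (by linarith) h2 h3 h4 (by linarith)
    have huv := hm u v h1 (by linarith) h5
    have huu : φ u ≤ φ u' := by
      rcases h2.eq_or_lt with h | h
      · rw [h]
      · exact (hm u u' h1 h (by linarith)).le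
    have hvv : φ v' ≤ φ v := by
      rcases h4.eq_or_lt with h | h
      · rw [h]
      · exact (hm v' v (by linarith) h h5).le
    have e2 := oddPow_ratio hd.le huu (hm u' v' (by linarith) h3 (by linarith)) hvv
    have hfm : f u < f v := hf (by linarith)
    have e3 : 2 * d * Real.exp (K * (v - u)) ≤ Real.exp (2 * d + 2 * K) := by
      rw [Real.exp_add]
      refine mul_le_mul ?_ (Real.exp_le_exp.2 (by nlinarith)) (Real.exp_pos _).le
        (Real.exp_pos _).le
      linarith [Real.add_one_le_exp (2 * d)]
    have q1 : f v' - f u' = oddPow d (φ v') - oddPow d (φ u') := by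
      rw [hfeq v' (by linarith) (by linarith), hfeq u' (by linarith) (by linarith)]; ring
    have q2 : f v - f u = oddPow d (φ v) - oddPow d (φ u) := by
      rw [hfeq v (by linarith) (by linarith), hfeq u (by linarith) (by linarith)]; ring
    rw [← q1, ← q2] at e2
    have hφp : 0 < φ v - φ u := by linarith
    refine le_of_mul_le_mul_right ?_ hφp
    calc (f v' - f u') * (v - u) * (φ v - φ u)
        = (f v' - f u') * (φ v - φ u) * (v - u) := by ring
      _ ≤ 2 * d * ((φ v' - φ u') * (f v - f u)) * (v - u) :=
          mul_le_mul_of_nonneg_right e2 (by linarith)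
      _ = 2 * d * (f v - f u) * ((φ v' - φ u') * (v - u)) := by ring
      _ ≤ 2 * d * (f v - f u) * (Real.exp (K * (v - u)) * ((v' - u') * (φ v - φ u))) :=
          mul_le_mul_of_nonneg_left e1 (mul_nonneg (by linarith) (by linarith))
      _ = 2 * d * Real.exp (K * (v - u)) * ((v' - u') * (f v - f u) * (φ v - φ u)) := by ring
      _ ≤ Real.exp (2 * d + 2 * K) * ((v' - u') * (f v - f u) * (φ v - φ u)) :=
          mul_le_mul_of_nonneg_right e3
            (mul_nonneg (mul_nonneg (by linarith) (by linarith)) (by linarith))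
      _ = _ := by ring
  · intro a b e z h1 h2 h3 h4 h5 hout
    have e1 := crossRatio_le_exp_of_ratio hK hmono hrat (by linarith) h2 h3 h4
      (by linarith)
    have side : 0 < φ a ∨ φ z < 0 := by
      rw [mem_Icc, not_and_or, not_le, not_le] at hout
      rcases hout with h | h
      · left; rw [← h0]; exact hm _ _ (by linarith) h (by linarith)
      · right; rw [← h0]; exact hm _ _ (by linarith) h (by linarith)
    have e2 := crossRatio_oddPow_le hd.le (hm a b h1 h2 (by linarith))
      (hm b e (by linarith) h3 (by linarith)) (hm e z (by linarith) h4 h5) side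
    have e3 : crossRatio (f a) (f b) (f e) (f z) =
        crossRatio (oddPow d (φ a)) (oddPow d (φ b)) (oddPow d (φ e)) (oddPow d (φ z)) := by
      rw [hfeq a (by linarith) (by linarith), hfeq b (by linarith) (by linarith),
        hfeq e (by linarith) (by linarith), hfeq z (by linarith) (by linarith)]
      simp only [crossRatio, add_sub_add_left_eq_sub]
    rw [e3]
    refine (e2.trans e1).trans (mul_le_mul_of_nonneg_right (Real.exp_le_exp.2 ?_)
      (crossRatio_nonneg h2.le h3.le h4.le))
    nlinarith

lemma LocalDistortion.mono {f : ℝ → ℝ} (hf : StrictMono f) {x r K K' : ℝ}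
    (h : LocalDistortion f x r K) (hK : K ≤ K') : LocalDistortion f x r K' := by
  obtain ⟨hr, hK0, h1, h2⟩ := h
  refine ⟨hr, hK0.trans hK, fun u u' v' v e1 e2 e3 e4 e5 => (h1 u u' v' v e1 e2 e3 e4 e5).trans ?_,
    fun a b c d e1 e2 e3 e4 e5 e6 => (h2 a b c d e1 e2 e3 e4 e5 e6).trans ?_⟩
  · have : f u < f v := hf (by linarith)
    exact mul_le_mul_of_nonneg_right (Real.exp_le_exp.2 hK)
      (mul_nonneg (by linarith) (by linarith))
  · refine mul_le_mul_of_nonneg_right (Real.exp_le_exp.2 ?_)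
      (crossRatio_nonneg e2.le e3.le e4.le)
    exact mul_le_mul_of_nonneg_right hK (by linarith)

lemma LocalDistortion.translate {f : ℝ → ℝ} {x r K k : ℝ} (h : LocalDistortion f x r K)
    (hk : ∀ x, f (x + k) = f x + k) : LocalDistortion f (x + k) r K := by
  have e : ∀ u, f u = f (u - k) + k := fun u => by rw [← hk, sub_add_cancel]
  obtain ⟨hr, hK0, h1, h2⟩ := h
  refine ⟨hr, hK0, fun u u' v' v e1 e2 e3 e4 e5 => ?_, fun a b c d e1 e2 e3 e4 e5 e6 => ?_⟩
  · have := h1 (u - k) (u' - k) (v' - k) (v - k) (by linarith) (by linarith) (by linarith)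
      (by linarith) (by linarith)
    rw [e u, e u', e v', e v]
    convert this using 2 <;> ring
  · have := h2 (a - k) (b - k) (c - k) (d - k) (by linarith) (by linarith) (by linarith)
      (by linarith) (by linarith) (fun h => e6 ⟨by linarith [h.1], by linarith [h.2]⟩)
    rw [e a, e b, e c, e d]
    simpa [crossRatio] using this

namespace IsCircleMapLift

variable {f : ℝ → ℝ}

lemma add_int (h : IsCircleMapLift f) (m : ℤ) (x : ℝ) : f (x + m) = f x + m := by
  have hn : ∀ (n : ℕ) x, f (x + n) = f x + n := by
    intro n
    induction n with
    | zero => simp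
    | succ n ih => intro x; push_cast; rw [← add_assoc, h.periodic, ih, add_assoc]
  obtain ⟨n, rfl | rfl⟩ := m.eq_nat_or_neg
  · simpa using hn n x
  · have := hn n (x + ((-(n : ℤ) : ℤ) : ℝ))
    push_cast at this ⊢
    rw [neg_add_cancel_right] at this
    linarith

lemma deriv_nonneg (h : IsCircleMapLift f) (x : ℝ) : 0 ≤ deriv f x :=
  h.mono.monotone.deriv_nonneg

lemma deriv_add_one (h : IsCircleMapLift f) (x : ℝ) : deriv f (x + 1) = deriv f x := by
  rw [← deriv_comp_add_const, funext h.periodic, deriv_add_const]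

lemma exists_lipschitz (h : IsCircleMapLift f) :
    ∃ L : ℝ, 0 < L ∧ ∀ u v, u ≤ v → f v - f u ≤ L * (v - u) := by
  have hc : Continuous (deriv f) := h.smooth.continuous_deriv (by norm_num)
  obtain ⟨L, hL⟩ := isCompact_Icc.exists_bound_of_continuousOn
    (s := Icc (0 : ℝ) 1) hc.continuousOn
  have hb : ∀ x, ‖deriv f x‖ ≤ L := fun x => by
    have hp : Function.Periodic (deriv f) 1 := h.deriv_add_one
    obtain ⟨y, hy, e⟩ := hp.exists_mem_Ico₀ one_pos x
    rw [e]
    exact hL y ⟨hy.1, hy.2.le⟩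
  refine ⟨max L 1, by positivity, fun u v huv => ?_⟩
  have := convex_univ.norm_image_sub_le_of_norm_deriv_le (𝕜 := ℝ) (f := f) (C := max L 1)
    (fun x _ => (h.smooth.differentiable (by norm_num)) x)
    (fun x _ => (hb x).trans (le_max_left _ _)) (mem_univ u) (mem_univ v)
  rw [Real.norm_eq_abs, Real.norm_eq_abs, abs_of_nonneg (sub_nonneg.2 huv)] at this
  exact (le_abs_self _).trans this

lemma exists_le_sub (h : IsCircleMapLift f) {δ : ℝ} (hδ : 0 < δ) :
    ∃ m : ℝ, 0 < m ∧ ∀ u v, u + δ ≤ v → m ≤ f v - f u := by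
  have hc : Continuous fun x => f (x + δ) - f x :=
    (h.smooth.continuous.comp (continuous_add_const δ)).sub h.smooth.continuous
  obtain ⟨z, -, hz⟩ := isCompact_Icc.exists_isMinOn (s := Icc (0 : ℝ) 1)
    (nonempty_Icc.2 zero_le_one) hc.continuousOn
  refine ⟨f (z + δ) - f z, sub_pos.2 (h.mono (by linarith)), fun u v huv => ?_⟩
  have hp : Function.Periodic (fun x => f (x + δ) - f x) 1 := fun x => by
    have := h.periodic (x + δ)
    rw [add_right_comm] at this
    simp only [h.periodic x, this]; ring
  obtain ⟨y, hy, e⟩ := hp.exists_mem_Ico₀ one_pos u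
  have h1 : f (z + δ) - f z ≤ f (y + δ) - f y := hz ⟨hy.1, hy.2.le⟩
  have h2 := h.mono.monotone huv
  linarith

end IsCircleMapLift

section

variable {f : ℝ → ℝ} {C : Finset ℝ} {dc : ℝ → ℝ}

lemma IsMulticriticalLift.exists_localDistortion (hf : IsMulticriticalLift f C dc) (x : ℝ) :
    ∃ r K, LocalDistortion f x r K := by
  obtain ⟨hl, -, -, hcrit, hnf⟩ := hf
  by_cases hx : deriv f x = 0
  · obtain ⟨c, hc, k, rfl⟩ := (hcrit x).1 hx
    exact localDistortion_of_isNonFlatCritPt ((hnf c hc).translate (hl.add_int k)) hl.mono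
  · exact localDistortion_of_deriv_pos (hl.smooth.contDiffAt.of_le (by norm_num))
      (lt_of_le_of_ne (hl.deriv_nonneg x) (Ne.symm hx))

/-- Finitely many centres and a uniform scale suffice for the local distortion bounds. -/
lemma IsMulticriticalLift.exists_uniform_localDistortion (hf : IsMulticriticalLift f C dc) :
    ∃ (X : Finset ℝ) (δ K : ℝ), 0 < δ ∧ 0 ≤ K ∧ ∀ u : ℝ, ∃ s ∈ X, ∃ (m : ℤ) (r : ℝ),
      LocalDistortion f (s + m) r K ∧ s + m - r < u ∧ u + δ ≤ s + m + r := by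
  have hl := hf.1
  choose r K hD using hf.exists_localDistortion
  obtain ⟨X, -, hX⟩ := (isCompact_Icc (a := (0 : ℝ)) (b := 1)).elim_nhds_subcover
    (fun x => Metric.ball x (r x)) fun x _ => Metric.ball_mem_nhds x (hD x).1
  obtain ⟨δ, hδ, hL⟩ := lebesgue_number_lemma_of_metric (isCompact_Icc (a := (0 : ℝ)) (b := 1))
    (c := fun i : X => Metric.ball (i : ℝ) (r i)) (fun i => Metric.isOpen_ball)
    (hX.trans fun y hy => by simpa using hy)
  refine ⟨X, δ / 2, ∑ s ∈ X, K s, by positivity, Finset.sum_nonneg fun s _ => (hD s).2.1,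
    fun u => ?_⟩
  obtain ⟨⟨s, hs⟩, hsub⟩ := hL (Int.fract u) ⟨Int.fract_nonneg u, (Int.fract_lt_one u).le⟩
  have h1 := hsub (Metric.mem_ball_self hδ)
  have h2 : Int.fract u + δ / 2 ∈ Metric.ball s (r s) :=
    hsub (by simp [abs_of_pos hδ, hδ])
  rw [Real.ball_eq_Ioo] at h1 h2
  have h3 := Int.floor_add_fract u
  refine ⟨s, hs, ⌊u⌋, r s, ((hD s).mono hl.mono ?_).translate (hl.add_int _), by linarith [h1.1],
    by linarith [h2.2]⟩
  exact Finset.single_le_sum (f := K) (fun s _ => (hD s).2.1) hs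

/-- Global cross-ratio distortion: a bounded factor is lost only on long arcs and on arcs
meeting `X`. -/
lemma IsMulticriticalLift.exists_crossRatio_le (hf : IsMulticriticalLift f C dc) :
    ∃ (X : Finset ℝ) (Λ : ℝ), 0 ≤ Λ ∧ ∀ a b c d d', a < b → b < c → c < d → d < d' →
      crossRatio (f a) (f b) (f c) (f d) ≤
        Real.exp (Λ * weight X a d') * crossRatio a b c d := by
  have hl := hf.1
  obtain ⟨X, δ, K, hδ, hK, hX⟩ := hf.exists_uniform_localDistortion
  obtain ⟨L, hL, hLip⟩ := hl.exists_lipschitz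
  obtain ⟨m₀, hm₀, hlow⟩ := hl.exists_le_sub hδ
  have hratio : ∀ u u' v' v, u ≤ u' → u' < v' → v' ≤ v →
      (f v' - f u') * (v - u) ≤
        Real.exp (K + L / m₀ + (v - u)) * ((v' - u') * (f v - f u)) := by
    intro u u' v' v h1 h2 h3
    have hfuv : f u < f v := hl.mono (by linarith)
    have hLm : 0 < L / m₀ := div_pos hL hm₀
    rcases lt_or_ge v (u + δ) with h4 | h4
    · obtain ⟨s, -, m, r, ⟨-, -, hd, -⟩, e1, e2⟩ := hX u
      refine (hd u u' v' v e1 h1 h2 h3 (by linarith)).trans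
        (mul_le_mul_of_nonneg_right (Real.exp_le_exp.2 (by linarith))
          (mul_nonneg (by linarith) (by linarith)))
    · have h5 := hlow u v h4
      have h6 := hLip u' v' h2.le
      have h7 : L * m₀ ≤ L * (f v - f u) := mul_le_mul_of_nonneg_left h5 hL.le
      have h8 : L ≤ L / m₀ * (f v - f u) := by
        rw [div_mul_eq_mul_div, le_div_iff₀ hm₀]; exact h7
      have h9 : L / m₀ * (v - u) ≤ Real.exp (K + L / m₀ + (v - u)) := by
        have e1 := Real.add_one_le_exp (L / m₀)
        have e2 := Real.add_one_le_exp (v - u)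
        calc L / m₀ * (v - u) ≤ Real.exp (L / m₀) * Real.exp (v - u) :=
              mul_le_mul (by linarith) (by linarith) (by linarith) (Real.exp_pos _).le
          _ = Real.exp (L / m₀ + (v - u)) := (Real.exp_add _ _).symm
          _ ≤ _ := Real.exp_le_exp.2 (by linarith)
      have hvu : 0 ≤ v - u := by linarith
      have hvu' : 0 ≤ v' - u' := by linarith
      calc (f v' - f u') * (v - u) ≤ (L * (v' - u')) * (v - u) :=
            mul_le_mul_of_nonneg_right h6 hvu
        _ = L * ((v' - u') * (v - u)) := by ring
        _ ≤ (L / m₀ * (f v - f u)) * ((v' - u') * (v - u)) :=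
            mul_le_mul_of_nonneg_right h8 (mul_nonneg hvu' hvu)
        _ = (L / m₀ * (v - u)) * ((v' - u') * (f v - f u)) := by ring
        _ ≤ _ := mul_le_mul_of_nonneg_right h9 (mul_nonneg hvu' (by linarith))
  obtain ⟨K₁, hK₁⟩ : ∃ K₁, K₁ = K + L / m₀ := ⟨_, rfl⟩
  have hK₁0 : 0 ≤ K₁ := by rw [hK₁]; positivity
  refine ⟨X, 2 * K₁ / δ + 2 * K₁ + 2 + K, by positivity, fun a b c d d' hab hbc hcd hd => ?_⟩
  have hcr := crossRatio_nonneg hab.le hbc.le hcd.le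
  have hw1 := sub_le_weight X a d'
  have hcoarse : crossRatio (f a) (f b) (f c) (f d) ≤
      Real.exp (2 * K₁ + 2 * (d - a)) * crossRatio a b c d := by
    refine (crossRatio_le_of_ratio hab hbc hcd (hl.mono hab) (hl.mono hbc) (hl.mono hcd)
      (Real.exp_pos _).le (hratio a a b c le_rfl hab hbc.le)
      (hratio b c d d hbc.le hcd le_rfl)).trans ?_
    rw [← Real.exp_add]
    refine mul_le_mul_of_nonneg_right (Real.exp_le_exp.2 ?_) hcr
    linarith
  have hΛ1 : 0 ≤ 2 * K₁ / δ := by positivity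
  have hw0 : 0 ≤ weight X a d' := by linarith
  have hdiv : 2 * K₁ = 2 * K₁ / δ * δ := by field_simp
  rcases le_or_gt (a + δ) d with hlong | hshort
  · refine hcoarse.trans (mul_le_mul_of_nonneg_right (Real.exp_le_exp.2 ?_) hcr)
    have h1 : 2 * K₁ / δ * δ ≤ 2 * K₁ / δ * weight X a d' :=
      mul_le_mul_of_nonneg_left (by linarith) hΛ1
    nlinarith
  · obtain ⟨s, hs, m, r, ⟨-, -, -, hd2⟩, e1, e2⟩ := hX a
    by_cases hmem : s + m ∈ Icc a d
    · refine hcoarse.trans (mul_le_mul_of_nonneg_right (Real.exp_le_exp.2 ?_) hcr)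
      have hw : (d - a) + 1 ≤ weight X a d' := by
        have h1 : s ∈ {s : ℝ | ∃ m : ℤ, s + m ∈ Ico a d'} :=
          ⟨m, hmem.1, by linarith [hmem.2]⟩
        have h2 : ∀ i ∈ X, 0 ≤ indicator {s : ℝ | ∃ m : ℤ, s + m ∈ Ico a d'}
            (fun _ => (1 : ℝ)) i := fun i _ => indicator_nonneg (fun _ _ => zero_le_one) i
        have h3 := Finset.single_le_sum h2 hs
        rw [indicator_of_mem h1] at h3
        rw [weight]
        linarith
      nlinarith [mul_nonneg hΛ1 hw0, mul_nonneg hK hw0,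
        mul_le_mul_of_nonneg_left hw hK₁0, mul_nonneg hK₁0 (by linarith : 0 ≤ d - a)]
    · refine (hd2 a b c d e1 hab hbc hcd (by linarith) hmem).trans
        (mul_le_mul_of_nonneg_right (Real.exp_le_exp.2 ?_) hcr)
      nlinarith [mul_nonneg hΛ1 hw0, mul_nonneg hK₁0 hw0,
        mul_le_mul_of_nonneg_left (by linarith : d - a ≤ weight X a d') hK]

/-- The cross-ratio inequality along an orbit. -/
lemma crossRatio_iterate_le (hmono : StrictMono f) {X : Finset ℝ} {Λ : ℝ}
    (h : ∀ a b c d d', a < b → b < c → c < d → d < d' →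
      crossRatio (f a) (f b) (f c) (f d) ≤ Real.exp (Λ * weight X a d') * crossRatio a b c d)
    (k : ℕ) {a b c d d' : ℝ} (hab : a < b) (hbc : b < c) (hcd : c < d) (hd : d < d') :
    crossRatio (f^[k] a) (f^[k] b) (f^[k] c) (f^[k] d) ≤
      Real.exp (Λ * ∑ i ∈ Finset.range k, weight X (f^[i] a) (f^[i] d')) *
        crossRatio a b c d := by
  induction k with
  | zero => simp
  | succ k ih =>
    have hk := hmono.iterate k
    simp only [Function.iterate_succ_apply']
    refine (h _ _ _ _ _ (hk hab) (hk hbc) (hk hcd) (hk hd)).trans ?_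
    refine (mul_le_mul_of_nonneg_left ih (Real.exp_pos _).le).trans ?_
    rw [← mul_assoc, ← Real.exp_add, Finset.sum_range_succ, mul_add, add_comm]

end

namespace IsRotAction

variable {f : ℝ → ℝ} {C : Finset ℝ} {dc : ℝ → ℝ} {ρ : ℝ} {act : ℤ × ℤ → ℝ → ℝ}

lemma iterate_strictMono (H : IsRotAction f ρ act) (k : ℕ) : StrictMono f^[k] := by
  have : f^[k] = act (k, 0) := funext fun x => (H.nat k x).symm
  rw [this]
  exact H.strictMono _

/-- Real bounds for cross-ratios: the first `S q_{n+1}` iterates distort the cross-ratio of points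
spanning at most `N` return arcs by a bounded factor. -/
lemma exists_crossRatio_iterate_le (H : IsRotAction f ρ act) (hf : GoodMap f C dc ρ) (N S : ℕ) :
    ∃ B : ℝ, 0 < B ∧ ∀ n k, k ≤ S * qden ρ (n + 1) → ∀ a b c d, a < b → b < c → c < d →
      d < act ((N : ℤ) • gam ρ n) a →
      crossRatio (f^[k] a) (f^[k] b) (f^[k] c) (f^[k] d) ≤ B * crossRatio a b c d := by
  obtain ⟨hm, -, hρ, h01⟩ := hf
  obtain ⟨X, Λ, hΛ, hX⟩ := hm.exists_crossRatio_le
  refine ⟨Real.exp (Λ * (S * (N * (2 + X.card)))), Real.exp_pos _,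
    fun n k hk a b c d hab hbc hcd hd => ?_⟩
  refine (crossRatio_iterate_le hm.1.mono hX k hab hbc hcd hd).trans ?_
  refine mul_le_mul_of_nonneg_right (Real.exp_le_exp.2 ?_)
    (crossRatio_nonneg hab.le hbc.le hcd.le)
  exact mul_le_mul_of_nonneg_left (H.sum_weight_smul_le hρ h01 X n N S hk a) hΛ

lemma exists_min_displacement (H : IsRotAction f ρ act) (p : ℤ × ℤ) :
    ∃ z, ∀ y, act p z - z ≤ act p y - y := by
  obtain ⟨z, -, hz⟩ := isCompact_Icc.exists_isMinOn (s := Icc (0 : ℝ) 1)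
    (nonempty_Icc.2 zero_le_one) ((H.continuous p).sub continuous_id).continuousOn
  refine ⟨z, fun y => ?_⟩
  have h1 : act p z - z ≤ act p (Int.fract y) - Int.fract y :=
    hz ⟨Int.fract_nonneg y, (Int.fract_lt_one y).le⟩
  have h2 := H.translate p (Int.fract y) ⌊y⌋
  rw [Int.fract_add_floor] at h2
  have h3 := Int.fract_add_floor y
  linarith

/-- The arcs `[w, act γₙ w)` with `w` in a long enough orbit segment cover the line. -/
lemma exists_cover (H : IsRotAction f ρ act) (hρ : Irrational ρ) (h01 : ρ ∈ Ioo (0 : ℝ) 1)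
    (n : ℕ) (k₀ : ℤ) (z y : ℝ) :
    ∃ p : ℤ × ℤ, k₀ ≤ p.1 ∧ p.1 < k₀ + qden ρ n + qden ρ (n + 1) ∧ act p z ≤ y ∧
      y < act (gam ρ n) (act p z) := by
  have hq := (qden_pos hρ n).1
  have hQ := (qden_pos hρ n).2
  obtain ⟨k, hk, hmax⟩ := Finset.exists_max_image
    (Finset.Ico k₀ (k₀ + qden ρ n + qden ρ (n + 1))) (fun k => act (k, ⌊y - act (k, 0) z⌋) z)
    ⟨k₀, by simp; omega⟩
  have hfl : ∀ k, act (k, ⌊y - act (k, 0) z⌋) z ≤ y := fun k => by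
    rw [H.int]
    linarith [Int.floor_le (y - act (k, 0) z)]
  have key : ∀ p : ℤ × ℤ, k₀ ≤ p.1 → p.1 < k₀ + qden ρ n + qden ρ (n + 1) → act p z ≤ y →
      act p z ≤ act (k, ⌊y - act (k, 0) z⌋) z := by
    rintro ⟨i, j⟩ h1 h2 h3
    refine le_trans ?_ (hmax i (Finset.mem_Ico.2 ⟨h1, h2⟩))
    rw [H.int i j] at h3
    rw [H.int i j, H.int i ⌊_⌋]
    have : j ≤ ⌊y - act (i, 0) z⌋ := Int.le_floor.2 (by linarith)
    have : (j : ℝ) ≤ (⌊y - act (i, 0) z⌋ : ℤ) := by exact_mod_cast this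
    linarith
  rw [Finset.mem_Ico] at hk
  obtain ⟨p, hp⟩ : ∃ p : ℤ × ℤ, p = (k, ⌊y - act (k, 0) z⌋) := ⟨_, rfl⟩
  have hp1 : p.1 = k := by rw [hp]
  have hpy := hfl k
  rw [← hp] at key hpy
  refine ⟨p, by omega, by omega, hpy, ?_⟩
  by_contra! hcon
  have hpos : ∀ n', act p z < act (gam ρ n') (act p z) := fun n' => by
    have := H.smul_lt hρ h01 n' zero_lt_one (act p z)
    rwa [zero_smul, one_smul, H.zero] at this
  have hle : act (gam ρ (n + 1)) (act p z) ≤ act (gam ρ n) (act p z) :=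
    H.le_of_rot_le hρ _ (by rw [rot_gam, rot_gam]; exact (theta_succ_lt hρ h01 n).le)
  have c1 : ¬(k₀ ≤ (gam ρ n + p).1 ∧ (gam ρ n + p).1 < k₀ + qden ρ n + qden ρ (n + 1)) := by
    rintro ⟨h1, h2⟩
    have := key _ h1 h2 (by rw [H.add]; exact hcon)
    rw [H.add] at this
    exact this.not_gt (hpos n)
  have c2 : ¬(k₀ ≤ (gam ρ (n + 1) + p).1 ∧
      (gam ρ (n + 1) + p).1 < k₀ + qden ρ n + qden ρ (n + 1)) := by
    rintro ⟨h1, h2⟩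
    have := key _ h1 h2 (by rw [H.add]; exact hle.trans hcon)
    rw [H.add] at this
    exact this.not_gt (hpos (n + 1))
  simp only [Prod.fst_add, gam, hp1, pow_succ] at c1 c2
  rcases neg_one_pow_eq_or ℤ n with h | h <;> rw [h] at c1 c2 <;> omega

/-- Return arcs along the backward orbit of a point of least displacement are comparable to
their neighbours. -/
lemma exists_adjacent_comparable (H : IsRotAction f ρ act) (hf : GoodMap f C dc ρ) (S : ℕ) :
    ∃ D : ℝ, 0 < D ∧ ∀ n z, (∀ y, act (gam ρ n) z - z ≤ act (gam ρ n) y - y) → ∀ p : ℤ × ℤ,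
      p.1 ≤ 0 → -(S * qden ρ (n + 1) : ℤ) ≤ p.1 → ∀ w, w = act p z →
      act ((1 : ℤ) • gam ρ n) w - w ≤
        D * (act ((2 : ℤ) • gam ρ n) w - act ((1 : ℤ) • gam ρ n) w) ∧
      act ((1 : ℤ) • gam ρ n) w - w ≤ D * (w - act ((-1 : ℤ) • gam ρ n) w) := by
  obtain ⟨B, hB, hcr⟩ := H.exists_crossRatio_iterate_le hf 4 S
  obtain ⟨hm, -, hρ, h01⟩ := hf
  refine ⟨4 * B, by positivity, fun n z hz p hp0 hpS w hw => ?_⟩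
  obtain ⟨k, hk⟩ := Int.eq_ofNat_of_zero_le (neg_nonneg.2 hp0)
  have hpull : ∀ v, f^[k] (act p v) = v + p.2 := fun v => by
    rw [← H.nat, ← H.add, show ((k : ℤ), (0 : ℤ)) + p = (0, p.2) by
      ext <;> simp; omega, H.int, show ((0 : ℤ), (0 : ℤ)) = 0 from rfl, H.zero]
  have hg : ∀ i : ℤ, f^[k] (act (i • gam ρ n) w) = act (i • gam ρ n) z + p.2 := fun i => by
    rw [hw, H.comm, hpull]
  have hg0 : f^[k] w = z + p.2 := by rw [hw, hpull]
  have e0 : ∀ v, act ((0 : ℤ) • gam ρ n) v = v := fun v => by rw [zero_smul, H.zero]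
  have mono : ∀ v, act ((-1 : ℤ) • gam ρ n) v < v ∧ v < act ((1 : ℤ) • gam ρ n) v ∧
      act ((1 : ℤ) • gam ρ n) v < act ((2 : ℤ) • gam ρ n) v := fun v =>
    ⟨by simpa only [e0] using H.smul_lt hρ h01 n (show (-1 : ℤ) < 0 by norm_num) v,
      by simpa only [e0] using H.smul_lt hρ h01 n (show (0 : ℤ) < 1 by norm_num) v,
      H.smul_lt hρ h01 n (by norm_num) v⟩
  obtain ⟨m1, m2, m3⟩ := mono w
  obtain ⟨m1', m2', m3'⟩ := mono z
  have h2 : act ((2 : ℤ) • gam ρ n) w <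
      act (((4 : ℕ) : ℤ) • gam ρ n) (act ((-1 : ℤ) • gam ρ n) w) := by
    rw [H.add_smul]
    exact H.smul_lt hρ h01 n (by norm_num) w
  have h := hcr n k (by zify; omega) _ _ _ _ m1 m2 m3 h2
  rw [hg, hg, hg, hg0] at h
  have hz1 := hz (act ((-1 : ℤ) • gam ρ n) z)
  have hz2 := hz (act ((1 : ℤ) • gam ρ n) z)
  have e1 : ∀ v, act (gam ρ n) v = act ((1 : ℤ) • gam ρ n) v := fun v => by rw [one_smul]
  rw [e1, e1 (act _ _), H.add_smul] at hz1 hz2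
  norm_num only at hz1 hz2
  rw [e0] at hz1
  simp only [crossRatio, add_sub_add_right_eq_sub] at h
  generalize act ((-1 : ℤ) • gam ρ n) w = A at *
  generalize act ((1 : ℤ) • gam ρ n) w = E at *
  generalize act ((2 : ℤ) • gam ρ n) w = F at *
  generalize act ((-1 : ℤ) • gam ρ n) z = a at *
  generalize act ((1 : ℤ) • gam ρ n) z = e at *
  generalize act ((2 : ℤ) • gam ρ n) z = φ at *
  have hq : 1 / 4 ≤ (z - a) * (φ - e) / ((e - a) * (φ - z)) := by
    rw [le_div_iff₀ (mul_pos (by linarith) (by linarith))]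
    have := mul_le_mul (by linarith : (e - a) ≤ 2 * (z - a)) (by linarith : φ - z ≤ 2 * (φ - e))
      (by linarith) (by linarith)
    linarith
  have h3 := hq.trans h
  rw [← mul_div_assoc, le_div_iff₀ (mul_pos (by linarith) (by linarith))] at h3
  have h4 : (E - w) * (F - E) ≤ (E - A) * (F - w) :=
    mul_le_mul (by linarith) (by linarith) (by linarith) (by linarith)
  have h5 : (w - A) * (E - w) ≤ (E - A) * (F - w) :=
    mul_le_mul (by linarith) (by linarith) (by linarith) (by linarith)
  constructor
  · refine le_of_mul_le_mul_left ?_ (sub_pos.2 m1)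
    linarith
  · refine le_of_mul_le_mul_right ?_ (sub_pos.2 m3)
    linarith

/-- Adjacent return arcs are uniformly comparable, at every point and every level. -/
lemma exists_comparable (H : IsRotAction f ρ act) (hf : GoodMap f C dc ρ) :
    ∃ K : ℝ, 1 ≤ K ∧ ∀ n y,
      act ((2 : ℤ) • gam ρ n) y - y ≤ K * (y - act ((-2 : ℤ) • gam ρ n) y) ∧
      y - act ((-2 : ℤ) • gam ρ n) y ≤ K * (act ((2 : ℤ) • gam ρ n) y - y) := by
  obtain ⟨D, hD, hadj⟩ := H.exists_adjacent_comparable hf 6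
  obtain ⟨-, -, hρ, h01⟩ := hf
  refine ⟨1 + D + D ^ 2 + D ^ 3, by linarith [pow_pos hD 2, pow_pos hD 3], fun n y => ?_⟩
  have hq := (qden_pos hρ n).1
  have hqQ := qden_le_succ hρ n
  obtain ⟨z, hz⟩ := H.exists_min_displacement (gam ρ n)
  obtain ⟨p, hp1, hp2, hp3, hp4⟩ := H.exists_cover hρ h01 n
    (-(3 * qden ρ n + qden ρ (n + 1)) : ℤ) z y
  obtain ⟨g, hg⟩ : ∃ g : ℤ → ℝ, ∀ i, g i = act (i • gam ρ n) (act p z) := ⟨_, fun _ => rfl⟩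
  have hgg : ∀ i j, act (i • gam ρ n) (g j) = g (i + j) := fun i j => by
    rw [hg, hg, H.add_smul]
  have hglt : ∀ i, g i < g (i + 1) := fun i => by
    rw [hg, hg]; exact H.smul_lt hρ h01 n (by omega) _
  have hcmp : ∀ i : ℤ, -2 ≤ i → i ≤ 2 →
      g (i + 1) - g i ≤ D * (g (i + 2) - g (i + 1)) ∧
      g (i + 1) - g i ≤ D * (g i - g (i - 1)) := by
    intro i hi1 hi2
    have h := hadj n z hz (i • gam ρ n + p) ?_ ?_ (g i) (by rw [hg, H.add])
    · rwa [hgg, hgg, hgg, add_comm, add_comm 2 i, neg_add_eq_sub] at h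
    · rw [Prod.fst_add, Prod.smul_fst, gam]
      rcases neg_one_pow_eq_or ℤ n with h | h <;> simp only [h, smul_eq_mul] <;>
        interval_cases i <;> omega
    · rw [Prod.fst_add, Prod.smul_fst, gam]
      rcases neg_one_pow_eq_or ℤ n with h | h <;> simp only [h, smul_eq_mul] <;>
        interval_cases i <;> push_cast <;> omega
  have e0 : act p z = g 0 := by rw [hg, zero_smul, H.zero]
  have e1 : act (gam ρ n) (act p z) = g 1 := by rw [hg, one_smul]
  rw [e0] at hp3
  rw [e1] at hp4
  have u1 := (H.strictMono ((2 : ℤ) • gam ρ n)).monotone hp3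
  have u2 := (H.strictMono ((2 : ℤ) • gam ρ n)) hp4
  have v1 := (H.strictMono ((-2 : ℤ) • gam ρ n)).monotone hp3
  have v2 := (H.strictMono ((-2 : ℤ) • gam ρ n)) hp4
  rw [hgg] at u1 u2 v1 v2
  have a0 := hcmp 0 (by norm_num) (by norm_num)
  have a1 := hcmp 1 (by norm_num) (by norm_num)
  have a2 := hcmp 2 (by norm_num) (by norm_num)
  have b1 := hcmp (-1) (by norm_num) (by norm_num)
  have b2 := hcmp (-2) (by norm_num) (by norm_num)
  have l0 := hglt 0
  have l1 := hglt 1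
  have l2 := hglt 2
  have k1 := hglt (-1)
  have k2 := hglt (-2)
  norm_num only at a0 a1 a2 b1 b2 u1 u2 v1 v2 l0 l1 l2 k1 k2
  have hD2 : 0 < D ^ 2 := pow_pos hD 2
  have hD3 : 0 < D ^ 3 := pow_pos hD 3
  have hK : 0 < 1 + D + D ^ 2 + D ^ 3 := by linarith
  constructor
  · have c1 : g 1 - g 0 ≤ D * (g 0 - g (-1)) := a0.2
    have c2 : g 2 - g 1 ≤ D ^ 2 * (g 0 - g (-1)) := by nlinarith [a1.2]
    have c3 : g 3 - g 2 ≤ D ^ 3 * (g 0 - g (-1)) := by nlinarith [a2.2]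
    have c4 := mul_le_mul_of_nonneg_left
      (by linarith : g 0 - g (-1) ≤ y - act ((-2 : ℤ) • gam ρ n) y) hK.le
    linarith
  · have c1 : g 1 - g 0 ≤ D * (g 2 - g 1) := a0.1
    have c2 : g 0 - g (-1) ≤ D ^ 2 * (g 2 - g 1) := by nlinarith [b1.1]
    have c3 : g (-1) - g (-2) ≤ D ^ 3 * (g 2 - g 1) := by nlinarith [b2.1]
    have c4 := mul_le_mul_of_nonneg_left
      (by linarith : g 2 - g 1 ≤ act ((2 : ℤ) • gam ρ n) y - y) hK.le
    linarith

end IsRotAction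

namespace IsRotAction

variable {f : ℝ → ℝ} {C : Finset ℝ} {dc : ℝ → ℝ} {ρ : ℝ} {act : ℤ × ℤ → ℝ → ℝ}

/-- Return arcs shrink uniformly to zero. -/
lemma exists_forall_smul_sub_lt (H : IsRotAction f ρ act) (hf : GoodMap f C dc ρ) {ε : ℝ}
    (hε : 0 < ε) : ∃ n₀, ∀ n ≥ n₀, ∀ y, act ((4 : ℤ) • gam ρ n) y - y < ε := by
  obtain ⟨K, hK, hcomp⟩ := H.exists_comparable hf
  obtain ⟨-, -, hρ, h01⟩ := hf
  have hanti : ∀ {m n : ℕ}, m ≤ n → ∀ y,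
      act ((2 : ℤ) • gam ρ n) y ≤ act ((2 : ℤ) • gam ρ m) y := fun h y =>
    H.le_of_rot_le hρ y (by
      rw [rot_smul, rot_smul, rot_gam, rot_gam]
      exact mul_le_mul_of_nonneg_left (theta_antitone hρ h01 h) (by norm_num))
  have h42 : ∀ n y, act ((4 : ℤ) • gam ρ (n + 2)) y ≤ act ((2 : ℤ) • gam ρ n) y := fun n y =>
    H.le_of_rot_le hρ y (by
      rw [rot_smul, rot_smul, rot_gam, rot_gam]
      push_cast
      linarith [two_mul_theta_le hρ h01 n])
  suffices h : ∃ n₀, ∀ y, act ((2 : ℤ) • gam ρ n₀) y - y < ε by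
    obtain ⟨n₀, hn₀⟩ := h
    refine ⟨n₀ + 2, fun n hn y => ?_⟩
    obtain ⟨m, rfl⟩ : ∃ m, n = m + 2 := ⟨n - 2, by omega⟩
    linarith [h42 m y, hanti (show n₀ ≤ m by omega) y, hn₀ y]
  by_contra! hcon
  obtain ⟨y, hy⟩ := IsCompact.nonempty_iInter_of_sequence_nonempty_isCompact_isClosed
    (fun n => Icc (0 : ℝ) 1 ∩ {y | ε ≤ act ((2 : ℤ) • gam ρ n) y - y})
    (fun n y hy => ⟨hy.1, le_trans hy.2 (sub_le_sub_right (hanti (Nat.le_succ n) y) y)⟩)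
    (fun n => by
      obtain ⟨y, hy⟩ := hcon n
      refine ⟨Int.fract y, ⟨Int.fract_nonneg y, (Int.fract_lt_one y).le⟩, ?_⟩
      have h1 := H.translate ((2 : ℤ) • gam ρ n) (Int.fract y) ⌊y⌋
      rw [Int.fract_add_floor] at h1
      have h2 := Int.fract_add_floor y
      rw [mem_ofPred_eq]
      linarith)
    (isCompact_Icc.inter_right
      (isClosed_le continuous_const ((H.continuous _).sub continuous_id)))
    (fun n => isClosed_Icc.inter
      (isClosed_le continuous_const ((H.continuous _).sub continuous_id)))
  rw [mem_iInter] at hy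
  have hy' : ∀ n, y + ε ≤ act ((2 : ℤ) • gam ρ n) y := fun n => by
    have : ε ≤ act ((2 : ℤ) • gam ρ n) y - y := (hy n).2
    linarith
  have hbdd : BddBelow (range fun n => act ((2 : ℤ) • gam ρ n) y) :=
    ⟨y + ε, by rintro _ ⟨n, rfl⟩; exact hy' n⟩
  have htend := tendsto_atTop_ciInf (fun m n h => hanti h y) hbdd
  have hble := ciInf_le hbdd
  have hbge : y + ε ≤ ⨅ n, act ((2 : ℤ) • gam ρ n) y := le_ciInf hy'
  generalize (⨅ n, act ((2 : ℤ) • gam ρ n) y) = b at htend hble hbge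
  have key : ∀ n, ε ≤ K * (act ((2 : ℤ) • gam ρ n) y - b) := by
    intro n
    have h1 := (hcomp (n + 2) b).2
    have h2 := (H.strictMono ((-2 : ℤ) • gam ρ (n + 2))).monotone (hble (n + 2))
    have h3 := (H.strictMono ((2 : ℤ) • gam ρ (n + 2))).monotone (hble (n + 2))
    rw [H.add_smul] at h2 h3
    norm_num only at h2 h3
    rw [zero_smul, H.zero] at h2
    have h4 := h42 n y
    have h5 := mul_le_mul_of_nonneg_left
      (by linarith : act ((2 : ℤ) • gam ρ (n + 2)) b - b ≤ act ((2 : ℤ) • gam ρ n) y - b)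
      (by linarith : 0 ≤ K)
    linarith
  have h0 : ε ≤ K * (b - b) := ge_of_tendsto ((htend.sub_const b).const_mul K)
    (Eventually.of_forall key)
  rw [sub_self, mul_zero] at h0
  linarith

/-- Along the first `q_{n+1}` iterates, the derivative at a point `n`-close to `c` is controlled by
the ratio of return arcs. -/
lemma exists_deriv_iterate_mul_le (H : IsRotAction f ρ act) (hf : GoodMap f C dc ρ) :
    ∃ B : ℝ, 0 < B ∧ ∀ n k, k < qden ρ (n + 1) → ∀ c x,
      act ((-1 : ℤ) • gam ρ n) c ≤ x → x ≤ act ((1 : ℤ) • gam ρ n) c →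
      deriv f^[k] x * |x - c| ≤ B * (act ((4 : ℤ) • gam ρ n) (f^[k] x) - f^[k] x) := by
  obtain ⟨K, hK, hcomp⟩ := H.exists_comparable hf
  obtain ⟨B, hB, hcr⟩ := H.exists_crossRatio_iterate_le hf 9 1
  obtain ⟨hm, -, hρ, h01⟩ := hf
  have hK2 : 0 < 1 + K + K ^ 2 := by positivity
  refine ⟨B * (1 + K + K ^ 2) * K, by positivity, fun n k hk c x hx1 hx2 => ?_⟩
  have hg : ∀ i : ℤ, f^[k] (act (i • gam ρ n) x) = act (i • gam ρ n) (f^[k] x) := fun i => by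
    rw [← H.nat, ← H.nat, H.comm]
  have hlt : ∀ {i j : ℤ}, i < j → ∀ v, act (i • gam ρ n) v < act (j • gam ρ n) v :=
    fun h v => H.smul_lt hρ h01 n h v
  have e0 : ∀ v, act ((0 : ℤ) • gam ρ n) v = v := fun v => by rw [zero_smul, H.zero]
  have x4 : x < act ((4 : ℤ) • gam ρ n) x := by
    simpa only [e0] using hlt (show (0 : ℤ) < 4 by norm_num) x
  have x8 := hlt (show (4 : ℤ) < 8 by norm_num) x
  have hmono := H.iterate_strictMono k
  have hdiff : DifferentiableAt ℝ f^[k] x :=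
    (hm.1.smooth.differentiable (by norm_num)).iterate k x
  have hlow : |x - c| ≤ K * (act ((4 : ℤ) • gam ρ n) x - x) := by
    have h1 := (H.strictMono ((4 : ℤ) • gam ρ n)).monotone hx1
    have h2 := (hcomp n (act ((1 : ℤ) • gam ρ n) c)).2
    rw [H.add_smul] at h1
    rw [H.add_smul, H.add_smul] at h2
    norm_num only at h1 h2
    have h3 : act ((-1 : ℤ) • gam ρ n) c < c := by
      simpa only [e0] using hlt (show (-1 : ℤ) < 0 by norm_num) c
    have h4 : c < act ((1 : ℤ) • gam ρ n) c := by
      simpa only [e0] using hlt (show (0 : ℤ) < 1 by norm_num) c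
    have h5 := mul_le_mul_of_nonneg_left (by linarith :
      act ((3 : ℤ) • gam ρ n) c - act ((1 : ℤ) • gam ρ n) c ≤ act ((4 : ℤ) • gam ρ n) x - x)
      (by linarith : 0 ≤ K)
    rw [abs_le]
    constructor <;> linarith
  obtain ⟨y, hy⟩ : ∃ y, y = f^[k] x := ⟨_, rfl⟩
  rw [← hy] at hg ⊢
  have hcmpy : act ((4 : ℤ) • gam ρ n) y - y ≤
      (K + K ^ 2) * (act ((8 : ℤ) • gam ρ n) y - act ((4 : ℤ) • gam ρ n) y) := by
    have h1 := (hcomp n (act ((2 : ℤ) • gam ρ n) y)).2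
    have h2 := (hcomp n (act ((4 : ℤ) • gam ρ n) y)).2
    simp only [H.add_smul] at h1 h2
    norm_num only at h1 h2
    rw [e0] at h1
    have h3 := hlt (show (6 : ℤ) < 8 by norm_num) y
    have h4 := mul_le_mul_of_nonneg_left h2 (by linarith : 0 ≤ K)
    have h5 := mul_le_mul_of_nonneg_left (by linarith : act ((6 : ℤ) • gam ρ n) y -
      act ((4 : ℤ) • gam ρ n) y ≤ act ((8 : ℤ) • gam ρ n) y - act ((4 : ℤ) • gam ρ n) y)
      (by positivity : 0 ≤ K + K ^ 2)
    linarith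
  have hslope : Tendsto (fun b => (f^[k] b - y) / (b - x)) (𝓝[>] x) (𝓝 (deriv f^[k] x)) := by
    have := hdiff.hasDerivAt.tendsto_slope.mono_left (nhdsGT_le_nhdsNE x)
    refine this.congr fun b => ?_
    rw [slope_def_field, hy]
  have y4 : y < act ((4 : ℤ) • gam ρ n) y := by
    simpa only [e0] using hlt (show (0 : ℤ) < 4 by norm_num) y
  have y8 := hlt (show (4 : ℤ) < 8 by norm_num) y
  have hbound : deriv f^[k] x * (act ((4 : ℤ) • gam ρ n) x - x) ≤
      B * (1 + K + K ^ 2) * (act ((4 : ℤ) • gam ρ n) y - y) := by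
    have hd : act ((8 : ℤ) • gam ρ n) x < act (((9 : ℕ) : ℤ) • gam ρ n) x :=
      hlt (by norm_num) x
    have hev : ∀ᶠ b in 𝓝[>] x, (f^[k] b - y) / (b - x) *
        (act ((4 : ℤ) • gam ρ n) x - x) ≤
        B * (1 + K + K ^ 2) * (act ((4 : ℤ) • gam ρ n) y - y) := by
      filter_upwards [Ioo_mem_nhdsGT x4] with b hb
      have h := hcr n k (by omega) x b _ _ hb.1 hb.2 x8 hd
      have hb1 := hmono hb.1
      have hb2 := hmono hb.2
      rw [← hy] at hb1
      rw [hg] at hb2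
      rw [hg, hg, ← hy] at h
      generalize f^[k] b = u at *
      generalize act ((4 : ℤ) • gam ρ n) x = c4 at *
      generalize act ((8 : ℤ) • gam ρ n) x = c8 at *
      generalize act ((4 : ℤ) • gam ρ n) y = d4 at *
      generalize act ((8 : ℤ) • gam ρ n) y = d8 at *
      obtain ⟨hb3, hb4⟩ := hb
      rw [crossRatio, crossRatio, ← mul_div_assoc,
        div_le_div_iff₀ (mul_pos (by linarith) (by linarith))
          (mul_pos (by linarith) (by linarith))] at h
      rw [div_mul_eq_mul_div, div_le_iff₀ (by linarith)]
      have p1 : 0 < (d8 - d4) * (c8 - b) := mul_pos (by linarith) (by linarith)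
      refine le_of_mul_le_mul_right ?_ p1
      have q1 : (c8 - c4) * (d8 - u) ≤ (c8 - b) * ((1 + K + K ^ 2) * (d8 - d4)) :=
        mul_le_mul (by linarith) (by linarith) (by linarith) (by linarith)
      have q2 := mul_le_mul_of_nonneg_left q1
        (mul_nonneg (mul_nonneg hB.le (by linarith : 0 ≤ b - x)) (by linarith : 0 ≤ d4 - y))
      linarith
    exact le_of_tendsto (hslope.mul_const _) hev
  have hder : 0 ≤ deriv f^[k] x := hmono.monotone.deriv_nonneg
  have h1 := mul_le_mul_of_nonneg_left hlow hder
  have h2 := mul_le_mul_of_nonneg_left hbound (by linarith : 0 ≤ K)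
  linarith

lemma sum_sq_smul_sub_le (H : IsRotAction f ρ act) (hρ : Irrational ρ)
    (h01 : ρ ∈ Ioo (0 : ℝ) 1) {n : ℕ} {ε : ℝ} (hε : ∀ y, act ((4 : ℤ) • gam ρ n) y - y < ε)
    {k : ℕ} (hk : k ≤ qden ρ (n + 1)) (x : ℝ) :
    ∑ i ∈ Finset.range k, (act ((4 : ℤ) • gam ρ n) (f^[i] x) - f^[i] x) ^ 2 ≤ ε * 8 := by
  have hpos : ∀ y, 0 < act ((4 : ℤ) • gam ρ n) y - y := fun y => by
    have := H.smul_lt hρ h01 n (show (0 : ℤ) < 4 by norm_num) y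
    rw [zero_smul, H.zero] at this
    linarith
  have hsum := H.sum_weight_smul_le hρ h01 ∅ n 4 1 (by simpa using hk) x
  have hg : ∀ i, f^[i] (act ((4 : ℤ) • gam ρ n) x) = act ((4 : ℤ) • gam ρ n) (f^[i] x) :=
    fun i => by rw [← H.nat, ← H.nat, H.comm]
  simp only [weight, Finset.sum_empty, add_zero, Nat.cast_ofNat, hg, Finset.card_empty,
    Nat.cast_zero, Nat.cast_one] at hsum
  have hε0 : 0 < ε := (hpos x).trans (hε x)
  calc _ ≤ ∑ i ∈ Finset.range k, ε * (act ((4 : ℤ) • gam ρ n) (f^[i] x) - f^[i] x) :=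
        Finset.sum_le_sum fun i _ => by
          rw [sq]
          exact mul_le_mul_of_nonneg_right (hε _).le (hpos _).le
    _ ≤ ε * 8 := by
        rw [← Finset.mul_sum]
        exact mul_le_mul_of_nonneg_left (by linarith) hε0.le

end IsRotAction

lemma schwarzian_eq (g : ℝ → ℝ) (x : ℝ) : schwarzian g x =
    deriv (deriv (deriv g)) x / deriv g x - 3 / 2 * (deriv (deriv g) x / deriv g x) ^ 2 := by
  rw [schwarzian, iteratedDeriv_succ, iteratedDeriv_succ, iteratedDeriv_one]

lemma schwarzian_congr {g h : ℝ → ℝ} {x : ℝ} (e : g =ᶠ[𝓝 x] h) :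
    schwarzian g x = schwarzian h x := by
  rw [schwarzian_eq, schwarzian_eq, e.deriv_eq, e.deriv.deriv_eq, e.deriv.deriv.deriv_eq]

/-- The chain rule for the Schwarzian derivative. -/
lemma schwarzian_comp {F g : ℝ → ℝ} {x : ℝ} (hF : ContDiffAt ℝ 3 F (g x))
    (hg : ContDiffAt ℝ 3 g x) (hF0 : deriv F (g x) ≠ 0) (hg0 : deriv g x ≠ 0) :
    schwarzian (F ∘ g) x = schwarzian F (g x) * deriv g x ^ 2 + schwarzian g x := by
  have eF := hg.continuousAt.eventually (hF.eventually (by simp))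
  have eg := hg.eventually (by simp)
  have e1 : deriv (F ∘ g) =ᶠ[𝓝 x] fun y => deriv F (g y) * deriv g y := by
    filter_upwards [eF, eg] with y h1 h2
    exact deriv_comp y (h1.differentiableAt (by norm_num)) (h2.differentiableAt (by norm_num))
  have e2 : deriv (deriv (F ∘ g)) =ᶠ[𝓝 x]
      fun y => deriv (deriv F) (g y) * deriv g y * deriv g y +
        deriv F (g y) * deriv (deriv g) y := by
    filter_upwards [eF, eg, e1.eventuallyEq_nhds] with y h1 h2 h3
    have d1 := ((contDiffAt_deriv h1 (m := 2) (by norm_num)).differentiableAt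
      (by norm_num)).hasDerivAt
    have d2 := ((contDiffAt_deriv h2 (m := 2) (by norm_num)).differentiableAt
      (by norm_num)).hasDerivAt
    have d3 := (h2.differentiableAt (by norm_num)).hasDerivAt
    rw [h3.deriv_eq]
    exact ((d1.comp y d3).mul d2).deriv
  have h1 := contDiffAt_deriv hF (m := 2) (by norm_num)
  have h2 := contDiffAt_deriv hg (m := 2) (by norm_num)
  have d1 := (h1.differentiableAt (by norm_num)).hasDerivAt
  have d1' := ((contDiffAt_deriv h1 (m := 1) (by norm_num)).differentiableAt
    (by norm_num)).hasDerivAt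
  have d2 := (h2.differentiableAt (by norm_num)).hasDerivAt
  have d2' := ((contDiffAt_deriv h2 (m := 1) (by norm_num)).differentiableAt
    (by norm_num)).hasDerivAt
  have d3 := (hg.differentiableAt (by norm_num)).hasDerivAt
  have e3 := ((((d1'.comp x d3).mul d2).mul d2).add ((d1.comp x d3).mul d2')).deriv.symm.trans
    (show _ = deriv (deriv (deriv (F ∘ g))) x from e2.deriv_eq.symm)
  rw [schwarzian_eq, schwarzian_eq, schwarzian_eq, ← e3, e2.self_of_nhds, e1.self_of_nhds]
  simp only [Function.comp_apply, Pi.mul_apply]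
  field_simp
  ring

lemma iterate_contDiff {f : ℝ → ℝ} {n : WithTop ℕ∞} (hf : ContDiff ℝ n f) (k : ℕ) :
    ContDiff ℝ n f^[k] := by
  induction k with
  | zero => exact contDiff_id
  | succ k ih => rw [Function.iterate_succ']; exact hf.comp ih

lemma deriv_iterate_succ {f : ℝ → ℝ} (hf : Differentiable ℝ f) (k : ℕ) (x : ℝ) :
    deriv f^[k + 1] x = deriv f (f^[k] x) * deriv f^[k] x := by
  rw [Function.iterate_succ']
  exact deriv_comp x (hf _) (hf.iterate k x)

lemma schwarzian_iterate {f : ℝ → ℝ} (hf : ContDiff ℝ 3 f) (j : ℕ) {x : ℝ}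
    (hx : deriv f^[j] x ≠ 0) : schwarzian f^[j] x =
      ∑ k ∈ Finset.range j, schwarzian f (f^[k] x) * deriv f^[k] x ^ 2 := by
  induction j with
  | zero => simp [schwarzian_eq, Function.iterate_zero]
  | succ j ih =>
    rw [deriv_iterate_succ (hf.differentiable (by norm_num))] at hx
    rw [Finset.sum_range_succ, ← ih (right_ne_zero_of_mul hx), Function.iterate_succ',
      schwarzian_comp hf.contDiffAt (iterate_contDiff hf j).contDiffAt (left_ne_zero_of_mul hx)
        (right_ne_zero_of_mul hx), add_comm]

lemma continuousAt_schwarzian {g : ℝ → ℝ} {x : ℝ} (hg : ContDiffAt ℝ 3 g x)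
    (hx : deriv g x ≠ 0) : ContinuousAt (schwarzian g) x := by
  have h1 := contDiffAt_deriv hg (m := 2) (by norm_num)
  have h2 := contDiffAt_deriv h1 (m := 1) (by norm_num)
  have h3 := contDiffAt_deriv h2 (m := 0) (by norm_num)
  rw [funext (schwarzian_eq g)]
  exact (h3.continuousAt.div h1.continuousAt hx).sub
    (((h2.continuousAt.div h1.continuousAt hx).pow 2).const_mul _)

/-- The Schwarzian derivative of a power map. -/
lemma schwarzian_rpow (a : ℝ) {b p t : ℝ} (hb : b ≠ 0) (hp : p ≠ 0) (ht : 0 < t) :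
    schwarzian (fun s => a + b * s ^ p) t = -((p ^ 2 - 1) / 2) / t ^ 2 := by
  have hd : ∀ (b q : ℝ) {s : ℝ}, 0 < s →
      HasDerivAt (fun s => b * s ^ q) (b * q * s ^ (q - 1)) s := fun b q s hs => by
    have := (Real.hasDerivAt_rpow_const (p := q) (Or.inl hs.ne')).const_mul b
    rwa [← mul_assoc] at this
  have ev : ∀ᶠ s in 𝓝 t, 0 < s := lt_mem_nhds ht
  have e1 : deriv (fun s => a + b * s ^ p) =ᶠ[𝓝 t] fun s => b * p * s ^ (p - 1) := by
    filter_upwards [ev] with s hs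
    rw [deriv_const_add]
    exact (hd b p hs).deriv
  have e2 : deriv (fun s => b * p * s ^ (p - 1)) =ᶠ[𝓝 t]
      fun s => b * p * (p - 1) * s ^ (p - 1 - 1) := by
    filter_upwards [ev] with s hs using (hd _ _ hs).deriv
  have e2' := e1.deriv.trans e2
  have e3 : deriv (deriv (deriv (fun s => a + b * s ^ p))) t =
      b * p * (p - 1) * (p - 1 - 1) * t ^ (p - 1 - 1 - 1) := by
    rw [e2'.deriv_eq]
    exact (hd _ _ ht).deriv
  rw [schwarzian_eq, e3, e2'.self_of_nhds, e1.self_of_nhds, Real.rpow_sub_one ht.ne' (p - 1 - 1)]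
  simp only [Real.rpow_sub_one ht.ne' (p - 1)]
  have := (Real.rpow_pos_of_pos ht (p - 1)).ne'
  generalize t ^ (p - 1) = u at this
  field_simp
  ring

lemma schwarzian_rpow_comp {v : ℝ → ℝ} {y : ℝ} (a : ℝ) {b p : ℝ} (hb : b ≠ 0) (hp : p ≠ 0)
    (hv : ContDiffAt ℝ 3 v y) (hv0 : 0 < v y) (hv' : deriv v y ≠ 0) :
    schwarzian (fun s => a + b * v s ^ p) y =
      -((p ^ 2 - 1) / 2) * (deriv v y / v y) ^ 2 + schwarzian v y := by
  have hF : ContDiffAt ℝ 3 (fun s : ℝ => a + b * s ^ p) (v y) :=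
    contDiffAt_const.add (contDiffAt_const.mul (Real.contDiffAt_rpow_const_of_ne hv0.ne'))
  have hF0 : deriv (fun s : ℝ => a + b * s ^ p) (v y) ≠ 0 := by
    rw [deriv_const_add, ((Real.hasDerivAt_rpow_const (p := p) (Or.inl hv0.ne')).const_mul b).deriv]
    exact mul_ne_zero hb (mul_ne_zero hp (Real.rpow_pos_of_pos hv0 _).ne')
  rw [show (fun s => a + b * v s ^ p) = (fun s => a + b * s ^ p) ∘ v from rfl,
    schwarzian_comp hF hv hF0 hv', schwarzian_rpow a hb hp hv0]
  field_simp

/-- Near a non-flat critical point the Schwarzian derivative tends to `-∞` quadratically. -/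
lemma IsNonFlatCritPt.exists_schwarzian_le {f : ℝ → ℝ} {c d : ℝ} (h : IsNonFlatCritPt f c d)
    (hf : StrictMono f) :
    ∃ κ : ℝ, 0 < κ ∧ ∀ᶠ y in 𝓝[≠] c, schwarzian f y ≤ -κ / (y - c) ^ 2 := by
  obtain ⟨hd, φ, hφ, h0, hφ', heq⟩ := h.exists_normalForm hf
  have hneg : ∀ y, deriv (fun y => -φ y) y = -deriv φ y := fun y => deriv.fun_neg
  have hκ : 0 < (d ^ 2 - 1) / 2 := by nlinarith
  have b1 : ∀ᶠ y in 𝓝 c, schwarzian φ y < schwarzian φ c + 1 :=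
    (continuousAt_schwarzian hφ hφ'.ne').eventually (gt_mem_nhds (by linarith))
  have b2 : ∀ᶠ y in 𝓝 c, schwarzian (fun y => -φ y) y < schwarzian (fun y => -φ y) c + 1 :=
    (continuousAt_schwarzian hφ.neg (by rw [hneg]; exact (neg_neg_of_pos hφ').ne)).eventually
      (gt_mem_nhds (by linarith))
  obtain ⟨M, hM1, hM2⟩ : ∃ M, schwarzian φ c + 1 ≤ M ∧ schwarzian (fun y => -φ y) c + 1 ≤ M :=
    ⟨_, le_max_left _ _, le_max_right _ _⟩
  obtain ⟨κ, hκe⟩ : ∃ κ, κ = (d ^ 2 - 1) / 2 / 16 := ⟨_, rfl⟩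
  have hκ0 : 0 < κ := by rw [hκe]; positivity
  have b3 : ∀ᶠ y in 𝓝 c, M * (y - c) ^ 2 < κ / 2 := by
    have : ContinuousAt (fun y => M * (y - c) ^ 2) c := by fun_prop
    refine this.eventually (gt_mem_nhds ?_)
    simp [hκ0]
  have b4 : ∀ᶠ y in 𝓝 c, deriv φ c / 2 < deriv φ y :=
    (contDiffAt_deriv hφ (m := 2) (by norm_num)).continuousAt.eventually
      (lt_mem_nhds (by linarith))
  have b5 : ∀ᶠ y in 𝓝 c, |φ y - deriv φ c * (y - c)| ≤ deriv φ c / 2 * |y - c| := by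
    have := ((hasDerivAt_iff_isLittleO.1 (hφ.differentiableAt (by norm_num)).hasDerivAt).def
      (half_pos hφ'))
    filter_upwards [this] with y hy
    rw [h0, Real.norm_eq_abs, Real.norm_eq_abs, smul_eq_mul, sub_zero, mul_comm (y - c)] at hy
    exact hy
  refine ⟨κ / 2, by positivity, ?_⟩
  rw [eventually_nhdsWithin_iff]
  filter_upwards [b1, b2, b3, b4, b5, hφ.eventually (by simp), heq.eventually_nhds]
    with y c1 c2 c3 c4 c5 c6 c7 hyc
  have hyc : y - c ≠ 0 := sub_ne_zero.2 hyc
  have habs : 0 < |y - c| := abs_pos.2 hyc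
  have hsq : 0 < (y - c) ^ 2 := by positivity
  have hup : |φ y| ≤ 2 * deriv φ c * |y - c| := by
    have := abs_sub_abs_le_abs_sub (φ y) (deriv φ c * (y - c))
    rw [abs_mul, abs_of_pos hφ'] at this
    linarith [mul_pos hφ' habs]
  have hlo : 0 < |φ y| := by
    have := abs_sub_abs_le_abs_sub (deriv φ c * (y - c)) (φ y)
    rw [abs_mul, abs_of_pos hφ', abs_sub_comm (_ * _)] at this
    linarith [mul_pos hφ' habs]
  have hφy : φ y ≠ 0 := abs_pos.1 hlo
  have hmain : 1 / 16 / (y - c) ^ 2 ≤ (deriv φ y / φ y) ^ 2 := by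
    rw [div_pow, div_le_div_iff₀ hsq (by positivity)]
    have h1 : φ y ^ 2 ≤ (2 * deriv φ c * |y - c|) ^ 2 := by
      rw [← sq_abs]; exact pow_le_pow_left₀ hlo.le hup 2
    rw [mul_pow, sq_abs] at h1
    have h2 : (deriv φ c / 2) ^ 2 ≤ deriv φ y ^ 2 :=
      pow_le_pow_left₀ (by positivity) c4.le 2
    nlinarith
  have hfin : ∀ s, s ≤ M → -((d ^ 2 - 1) / 2) * (deriv φ y / φ y) ^ 2 + s ≤
      -(κ / 2) / (y - c) ^ 2 := by
    intro s hs
    have h1 := mul_le_mul_of_nonneg_left hmain hκ.le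
    have h2 : M ≤ κ / 2 / (y - c) ^ 2 := by
      rw [le_div_iff₀ hsq]; exact c3.le
    have h3 : (d ^ 2 - 1) / 2 * (1 / 16 / (y - c) ^ 2) =
        κ / 2 / (y - c) ^ 2 + κ / 2 / (y - c) ^ 2 := by
      rw [hκe]; field_simp; norm_num
    rw [neg_div]
    linarith
  have hd0 : d ≠ 0 := by linarith
  rcases lt_or_gt_of_ne hφy with hs | hs
  · have e : f =ᶠ[𝓝 y] fun s => f c + (-1) * (-φ s) ^ d := by
      filter_upwards [c7, c6.continuousAt.eventually (gt_mem_nhds hs)] with s h1 h2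
      rw [h1, ← neg_neg (φ s), oddPow_neg, oddPow_of_pos d (by linarith : 0 < -φ s), neg_neg]
      ring
    have := schwarzian_rpow_comp (v := fun s => -φ s) (f c) (b := -1) (by norm_num) hd0
      c6.neg (by linarith) (by rw [hneg]; linarith)
    rw [schwarzian_congr e, this, hneg, neg_div_neg_eq]
    exact hfin _ (by linarith)
  · have e : f =ᶠ[𝓝 y] fun s => f c + 1 * φ s ^ d := by
      filter_upwards [c7, c6.continuousAt.eventually (lt_mem_nhds hs)] with s h1 h2
      rw [h1, oddPow_of_pos d h2, one_mul]
    rw [schwarzian_congr e, schwarzian_rpow_comp (f c) one_ne_zero hd0 c6 hs (by linarith)]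
    exact hfin _ (by linarith)

lemma periodic_deriv {g : ℝ → ℝ} (h : Function.Periodic g 1) : Function.Periodic (deriv g) 1 :=
  fun x => by rw [← deriv_comp_add_const, funext h]

lemma IsMulticriticalLift.exists_schwarzian_le {f : ℝ → ℝ} {C : Finset ℝ} {dc : ℝ → ℝ}
    (hf : IsMulticriticalLift f C dc) :
    ∃ M : ℝ, 0 ≤ M ∧ ∀ x, deriv f x ≠ 0 → schwarzian f x ≤ M := by
  obtain ⟨hl, -, -, hcrit, hnf⟩ := hf
  have hloc : ∀ x, ∃ M, ∀ᶠ y in 𝓝 x, deriv f y ≠ 0 → schwarzian f y ≤ M := by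
    intro x
    by_cases hx : deriv f x = 0
    · obtain ⟨c, hc, k, rfl⟩ := (hcrit x).1 hx
      obtain ⟨κ, hκ, h⟩ := ((hnf c hc).translate (hl.add_int k)).exists_schwarzian_le hl.mono
      refine ⟨0, ?_⟩
      rw [eventually_nhdsWithin_iff] at h
      filter_upwards [h] with y hy hy'
      refine (hy fun e => hy' (by rw [e]; exact hx)).trans ?_
      exact div_nonpos_of_nonpos_of_nonneg (by linarith) (sq_nonneg _)
    · refine ⟨schwarzian f x + 1, ?_⟩
      filter_upwards [(continuousAt_schwarzian hl.smooth.contDiffAt hx).eventually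
        (gt_mem_nhds (lt_add_one _))] with y hy _ using hy.le
  obtain ⟨M, hM⟩ : ∃ M, ∀ y ∈ Icc (0 : ℝ) 1, deriv f y ≠ 0 → schwarzian f y ≤ M := by
    refine isCompact_Icc.induction_on (p := fun s => ∃ M, ∀ y ∈ s, deriv f y ≠ 0 →
      schwarzian f y ≤ M) ⟨0, by simp⟩ ?_ ?_ ?_
    · rintro s t hst ⟨M, hM⟩
      exact ⟨M, fun y hy => hM y (hst hy)⟩
    · rintro s t ⟨M, hM⟩ ⟨M', hM'⟩
      refine ⟨max M M', fun y hy hy' => ?_⟩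
      rcases hy with hy | hy
      · exact (hM y hy hy').trans (le_max_left _ _)
      · exact (hM' y hy hy').trans (le_max_right _ _)
    · intro x _
      obtain ⟨M, hM⟩ := hloc x
      exact ⟨_, mem_nhdsWithin_of_mem_nhds hM, M, fun y hy => hy⟩
  have p1 : Function.Periodic (deriv f) 1 := hl.deriv_add_one
  have p2 := periodic_deriv p1
  have p3 := periodic_deriv p2
  have hp : Function.Periodic (fun x => (deriv f x, schwarzian f x)) 1 := fun x => by
    simp only [schwarzian_eq, p1 x, p2 x, p3 x]
  refine ⟨max M 0, le_max_right _ _, fun x hx => ?_⟩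
  obtain ⟨y, hy, e⟩ := hp.exists_mem_Ico₀ one_pos x
  rw [Prod.mk.injEq] at e
  rw [e.1] at hx
  rw [e.2]
  exact (hM y ⟨hy.1, hy.2.le⟩ hx).trans (le_max_left _ _)

namespace IsRotAction

variable {f : ℝ → ℝ} {C : Finset ℝ} {dc : ℝ → ℝ} {ρ : ℝ} {act : ℤ × ℤ → ℝ → ℝ}

lemma arcI_subset_Icc (H : IsRotAction f ρ act) (hρ : Irrational ρ) (h01 : ρ ∈ Ioo (0 : ℝ) 1)
    (n : ℕ) (c : ℝ) :
    arcI f ρ c n ⊆ Icc (act ((-1 : ℤ) • gam ρ n) c) (act ((1 : ℤ) • gam ρ n) c) := by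
  have hret : retPt f ρ c n = act ((qden ρ n : ℤ), -(pnum ρ n : ℤ)) c := by
    rw [H.int, H.nat, retPt]
    push_cast
    ring
  have h0 : act ((0 : ℤ) • gam ρ n) c = c := by rw [zero_smul, H.zero]
  have h1 := H.smul_le hρ h01 n (show (-1 : ℤ) ≤ 0 by norm_num) c
  have h2 := H.smul_le hρ h01 n (show (0 : ℤ) ≤ 1 by norm_num) c
  rw [h0] at h1 h2
  refine uIcc_subset_Icc ⟨h1, h2⟩ ?_
  rcases n.even_or_odd with hn | hn
  · have : ((qden ρ n : ℤ), -(pnum ρ n : ℤ)) = (1 : ℤ) • gam ρ n := by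
      simp [gam, hn.neg_one_pow]
    rw [hret, this]
    exact ⟨h1.trans h2, le_rfl⟩
  · have : ((qden ρ n : ℤ), -(pnum ρ n : ℤ)) = (-1 : ℤ) • gam ρ n := by
      simp [gam, hn.neg_one_pow]
    rw [hret, this]
    exact ⟨le_rfl, h1.trans h2⟩

end IsRotAction

/-- For large `n`, the contribution of the initial point near `c₀` to the Schwarzian derivative of
`f^[j]` dominates the contributions of the rest of the orbit. -/
lemma GoodMap.exists_schwarzian_iterate_neg {f : ℝ → ℝ} {C : Finset ℝ} {dc : ℝ → ℝ} {ρ c₀ : ℝ}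
    (hf : GoodMap f C dc ρ) (hc₀ : c₀ ∈ C) :
    ∃ n₁ : ℕ, ∀ n ≥ n₁, ∀ j : ℕ, 1 ≤ j → j ≤ qden ρ (n + 1) → ∀ x ∈ arcI f ρ c₀ n,
      deriv (f^[j]) x ≠ 0 → schwarzian (f^[j]) x < 0 := by
  obtain ⟨act, H⟩ := exists_isRotAction hf
  obtain ⟨hm, -, hρ, h01⟩ := id hf
  obtain ⟨hl, -, -, hcrit, hnf⟩ := id hm
  obtain ⟨κ, hκ, hev⟩ := (hnf c₀ hc₀).exists_schwarzian_le hl.mono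
  rw [eventually_nhdsWithin_iff, Metric.eventually_nhds_iff] at hev
  obtain ⟨r, hr, hnear⟩ := hev
  obtain ⟨M, hM, hSM⟩ := hm.exists_schwarzian_le
  obtain ⟨B, hB, hBd⟩ := H.exists_deriv_iterate_mul_le hf
  obtain ⟨ε, hε, hεr, hεκ⟩ : ∃ ε > 0, ε ≤ r ∧ M * (B ^ 2 * (ε * 8)) < κ := by
    refine ⟨min r (κ / (8 * M * B ^ 2 + 1)), lt_min hr (by positivity), min_le_left _ _, ?_⟩
    have h := (le_div_iff₀ (by positivity)).1 (min_le_right r (κ / (8 * M * B ^ 2 + 1)))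
    have : 0 < min r (κ / (8 * M * B ^ 2 + 1)) := lt_min hr (by positivity)
    linarith
  obtain ⟨n₁, hn₁⟩ := H.exists_forall_smul_sub_lt hf hε
  refine ⟨n₁, fun n hn j hj1 hj x hx hreg => ?_⟩
  obtain ⟨hx1, hx2⟩ := H.arcI_subset_Icc hρ h01 n c₀ hx
  have hdiff : Differentiable ℝ f := hl.smooth.differentiable (by norm_num)
  have hreg' : ∀ k < j, deriv f (f^[k] x) ≠ 0 := by
    intro k hk h0
    obtain ⟨i, rfl⟩ := Nat.exists_eq_add_of_lt hk
    refine hreg ?_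
    rw [show k + i + 1 = i + (k + 1) by ring, Function.iterate_add,
      deriv_comp x (hdiff.iterate i _) (hdiff.iterate (k + 1) x), deriv_iterate_succ hdiff, h0,
      zero_mul, mul_zero]
  have hxc : x ≠ c₀ := by
    rintro rfl
    exact hreg' 0 hj1 ((hcrit _).2 ⟨x, hc₀, 0, by simp⟩)
  have hsq : 0 < (x - c₀) ^ 2 := sq_pos_of_ne_zero (sub_ne_zero.2 hxc)
  have hdist : dist x c₀ < r := by
    have h0 : act ((0 : ℤ) • gam ρ n) c₀ = c₀ := by rw [zero_smul, H.zero]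
    have h1 := H.smul_le hρ h01 n (show (-1 : ℤ) ≤ 0 by norm_num) c₀
    have h2 := H.smul_le hρ h01 n (show (0 : ℤ) ≤ 1 by norm_num) c₀
    have h3 := H.smul_le hρ h01 n (show (1 : ℤ) ≤ 4 + -1 by norm_num) c₀
    have h4 := hn₁ n hn (act ((-1 : ℤ) • gam ρ n) c₀)
    rw [H.add_smul] at h4
    rw [h0] at h1 h2
    rw [Real.dist_eq, abs_lt]
    constructor <;> linarith
  have hfirst : schwarzian f x * (x - c₀) ^ 2 ≤ -κ := (le_div_iff₀ hsq).1 (hnear hdist hxc)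
  obtain ⟨i, rfl⟩ := Nat.exists_eq_succ_of_ne_zero (Nat.one_le_iff_ne_zero.1 hj1)
  have hterm : ∀ k ∈ Finset.range (i + 1),
      schwarzian f (f^[k] x) * deriv f^[k] x ^ 2 * (x - c₀) ^ 2 ≤
        M * (B ^ 2 * (act ((4 : ℤ) • gam ρ n) (f^[k] x) - f^[k] x) ^ 2) := by
    intro k hk
    have hk := Finset.mem_range.1 hk
    have h := hBd n k (hk.trans_le hj) c₀ x hx1 hx2
    have hd : 0 ≤ deriv f^[k] x := (hl.mono.iterate k).monotone.deriv_nonneg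
    have h2 := pow_le_pow_left₀ (by positivity) h 2
    rw [mul_pow, sq_abs, mul_pow] at h2
    rw [mul_assoc]
    exact mul_le_mul (hSM _ (hreg' k hk)) h2 (by positivity) hM
  have hsum := H.sum_sq_smul_sub_le hρ h01 (hn₁ n hn) hj x
  have hrest : ∑ k ∈ Finset.range i,
      schwarzian f (f^[k + 1] x) * deriv f^[k + 1] x ^ 2 * (x - c₀) ^ 2 ≤
        M * (B ^ 2 * (ε * 8)) := by
    calc _ ≤ ∑ k ∈ Finset.range i,
          M * (B ^ 2 * (act ((4 : ℤ) • gam ρ n) (f^[k + 1] x) - f^[k + 1] x) ^ 2) :=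
        Finset.sum_le_sum fun k hk => hterm _ (by simpa using hk)
      _ ≤ ∑ k ∈ Finset.range (i + 1),
          M * (B ^ 2 * (act ((4 : ℤ) • gam ρ n) (f^[k] x) - f^[k] x) ^ 2) := by
        rw [Finset.sum_range_succ' _ i]
        exact le_add_of_nonneg_right (by positivity)
      _ ≤ _ := by
        rw [← Finset.mul_sum, ← Finset.mul_sum]
        gcongr
  have htot : schwarzian f^[i + 1] x * (x - c₀) ^ 2 < 0 := by
    rw [schwarzian_iterate hl.smooth _ hreg, Finset.sum_mul, Finset.sum_range_succ']
    simp only [Function.iterate_zero, id_eq, one_pow, mul_one, deriv_id]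
    linarith
  exact neg_of_mul_neg_left htot hsq.le

end MCircle

open MCircle

/-- **The negative Schwarzian property** (Lemma 4.1). For a multicritical circle map
`f` with irrational rotation number and fixed critical point `c₀` there is
`n₁ = n₁(f)` such that for all `n ≥ n₁`: `Sf^j(x) < 0` for all `j ∈ {1,…,q_{n+1}}`
and all regular points `x ∈ Iₙ` of `f^j`; and likewise `Sf^j(x) < 0` for all
`j ∈ {1,…,qₙ}` and all regular points `x ∈ I_{n+1}` of `f^j`. -/
theorem negative_schwarzian (f : ℝ → ℝ) (C : Finset ℝ) (dc : ℝ → ℝ) (ρ c₀ : ℝ)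
    (hf : GoodMap f C dc ρ) (hc₀ : c₀ ∈ C) :
    ∃ n₁ : ℕ, ∀ n ≥ n₁,
      (∀ j : ℕ, 1 ≤ j → j ≤ qden ρ (n + 1) → ∀ x ∈ arcI f ρ c₀ n,
        deriv (f^[j]) x ≠ 0 → schwarzian (f^[j]) x < 0) ∧
      (∀ j : ℕ, 1 ≤ j → j ≤ qden ρ n → ∀ x ∈ arcI f ρ c₀ (n + 1),
        deriv (f^[j]) x ≠ 0 → schwarzian (f^[j]) x < 0) := by
  obtain ⟨n₁, h⟩ := hf.exists_schwarzian_iterate_neg hc₀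
  obtain ⟨-, -, hρ, -⟩ := hf
  refine ⟨n₁, fun n hn => ⟨h n hn, fun j hj1 hj => h (n + 1) (by omega) j hj1 (hj.trans ?_)⟩⟩
  exact (qden_le_succ hρ n).trans (qden_le_succ hρ (n + 1))
end
end

section
/- Let f be a C³ real map with a non-flat critical point c of degree d > 1, i.e., f(x) = f(c) + φ(x)|φ(x)|^{d−1} on a neighborhood W of c, where φ: W → φ(W) is a C³ diffeomorphism with φ(c) = 0. Then there exist a neighborhood U ⊆ W of c and a constant K = K(f) > 0 such that for all x ∈ U ∖ {c}, the Schwarzian derivative satisfies Sf(x) < −K/(x−c)²; in particular f has negative Schwarzian derivative on U ∖ {c}. -/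
open Set Filter Topology
open scoped ENNReal

noncomputable section

open MCircle

theorem hasDerivAt_abs_rpow_comp {φ : ℝ → ℝ} {x a : ℝ} (r : ℝ) (hφ : HasDerivAt φ a x)
    (h0 : φ x ≠ 0) :
    HasDerivAt (fun y => |φ y| ^ r) (r * |φ x| ^ r * a / φ x) x := by
  have hpos : 0 < |φ x| := abs_pos.mpr h0
  have hd := ((hasDerivAt_abs h0).comp x hφ).rpow_const (p := r) (Or.inl hpos.ne')
  refine hd.congr_deriv ?_
  rw [Function.comp_apply, Real.rpow_sub_one hpos.ne']
  rcases lt_or_gt_of_ne h0 with h | h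
  · simp only [abs_of_neg h, sign_neg h, SignType.coe_neg_one]
    field_simp
  · simp only [abs_of_pos h, sign_pos h, SignType.coe_one]
    field_simp

theorem schwarzian_eq_of_hasDerivAt {f f₁ f₂ f₃ : ℝ → ℝ} {V : Set ℝ} (hV : IsOpen V)
    (h₁ : ∀ x ∈ V, HasDerivAt f (f₁ x) x) (h₂ : ∀ x ∈ V, HasDerivAt f₁ (f₂ x) x)
    (h₃ : ∀ x ∈ V, HasDerivAt f₂ (f₃ x) x) {x : ℝ} (hx : x ∈ V) :
    schwarzian f x = f₃ x / f₁ x - (3 / 2) * (f₂ x / f₁ x) ^ 2 := by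
  have e₁ : ∀ y ∈ V, deriv f y = f₁ y := fun y hy => (h₁ y hy).deriv
  have e₂ : ∀ y ∈ V, iteratedDeriv 2 f y = f₂ y := fun y hy => by
    rw [iteratedDeriv_succ, iteratedDeriv_one]
    exact (EventuallyEq.deriv_eq (eventually_of_mem (hV.mem_nhds hy) e₁)).trans (h₂ y hy).deriv
  have e₃ : iteratedDeriv 3 f x = f₃ x := by
    rw [iteratedDeriv_succ]
    exact (EventuallyEq.deriv_eq (eventually_of_mem (hV.mem_nhds hx) e₂)).trans (h₃ x hx).deriv
  rw [schwarzian, e₁ x hx, e₂ x hx, e₃]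

/-- Composition formula for the Schwarzian derivative of `φ` followed by the power map
`y ↦ y * |y| ^ (d - 1)`, whose Schwarzian derivative is `-(d ^ 2 - 1) / (2 * y ^ 2)`. -/
theorem schwarzian_add_mul_abs_rpow {f φ φ₁ φ₂ φ₃ : ℝ → ℝ} {a d : ℝ} {V : Set ℝ}
    (hV : IsOpen V) (hd : d ≠ 0)
    (h₁ : ∀ x ∈ V, HasDerivAt φ (φ₁ x) x) (h₂ : ∀ x ∈ V, HasDerivAt φ₁ (φ₂ x) x)
    (h₃ : ∀ x ∈ V, HasDerivAt φ₂ (φ₃ x) x) (h0 : ∀ x ∈ V, φ x ≠ 0) (h0' : ∀ x ∈ V, φ₁ x ≠ 0)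
    (heq : ∀ x ∈ V, f x = a + φ x * |φ x| ^ (d - 1)) {x : ℝ} (hx : x ∈ V) :
    schwarzian f x = φ₃ x / φ₁ x - (3 / 2) * (φ₂ x / φ₁ x) ^ 2
      - (d ^ 2 - 1) / 2 * (φ₁ x / φ x) ^ 2 := by
  have hp : ∀ y ∈ V, HasDerivAt (fun z => |φ z| ^ (d - 1))
      ((d - 1) * |φ y| ^ (d - 1) * φ₁ y / φ y) y :=
    fun y hy => hasDerivAt_abs_rpow_comp (d - 1) (h₁ y hy) (h0 y hy)
  have g₁ : ∀ y ∈ V, HasDerivAt f (d * (|φ y| ^ (d - 1) * φ₁ y)) y := fun y hy => by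
    have h := ((h₁ y hy).fun_mul (hp y hy)).const_add a
    refine (h.congr_of_eventuallyEq (eventually_of_mem (hV.mem_nhds hy) heq)).congr_deriv ?_
    have := h0 y hy
    field_simp
    ring
  have g₂ : ∀ y ∈ V, HasDerivAt (fun z => d * (|φ z| ^ (d - 1) * φ₁ z))
      (d * (|φ y| ^ (d - 1) * ((d - 1) * (φ₁ y ^ 2 / φ y) + φ₂ y))) y := fun y hy => by
    refine (((hp y hy).fun_mul (h₂ y hy)).const_mul d).congr_deriv ?_
    have := h0 y hy
    field_simp
  have g₃ : ∀ y ∈ V, HasDerivAt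
      (fun z => d * (|φ z| ^ (d - 1) * ((d - 1) * (φ₁ z ^ 2 / φ z) + φ₂ z)))
      (d * (|φ y| ^ (d - 1) * ((d - 1) * (d - 2) * φ₁ y ^ 3 / φ y ^ 2
        + 3 * (d - 1) * φ₁ y * φ₂ y / φ y + φ₃ y))) y := fun y hy => by
    have h := ((((h₂ y hy).fun_pow 2).fun_div (h₁ y hy) (h0 y hy)).const_mul (d - 1)).fun_add
      (h₃ y hy)
    refine (((hp y hy).fun_mul h).const_mul d).congr_deriv ?_
    have := h0 y hy
    field_simp
    ring
  rw [schwarzian_eq_of_hasDerivAt hV g₁ g₂ g₃ hx]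
  have k0 := h0 x hx
  have k1 := h0' x hx
  have kp : |φ x| ^ (d - 1) ≠ 0 := (Real.rpow_pos_of_pos (abs_pos.mpr k0) _).ne'
  generalize |φ x| ^ (d - 1) = p at kp
  field_simp
  ring

/-- **Negative Schwarzian near a non-flat critical point** (Lemma 2.4, item 1). If `f`
is `C³` with a non-flat critical point `c` of degree `d > 1`, i.e.
`f(x) = f(c) + φ(x)|φ(x)|^{d-1}` on a neighbourhood `W` of `c` with `φ` a `C³` diffeo,
`φ(c) = 0`, then there are a neighbourhood `U ⊆ W` of `c` and `K = K(f) > 0` such that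
`Sf(x) < -K/(x-c)²` for all `x ∈ U ∖ {c}`; in particular `Sf < 0` on `U ∖ {c}`. -/
theorem nonflat_neg_schwarzian (f φ : ℝ → ℝ) (c d : ℝ) (W : Set ℝ)
    (hf : ContDiff ℝ 3 f) (hd : 1 < d) (hW : IsOpen W) (hcW : c ∈ W)
    (hφ : ContDiffOn ℝ 3 φ W) (hφc : φ c = 0) (hφ' : ∀ x ∈ W, deriv φ x ≠ 0)
    (hφinj : InjOn φ W)
    (heq : ∀ x ∈ W, f x = f c + φ x * |φ x| ^ (d - 1)) :
    ∃ U : Set ℝ, IsOpen U ∧ c ∈ U ∧ U ⊆ W ∧ ∃ K : ℝ, 0 < K ∧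
      ∀ x ∈ U, x ≠ c → schwarzian f x < -K / (x - c) ^ 2 ∧ schwarzian f x < 0 := by
  have hφ₁ : ContDiffOn ℝ 2 (deriv φ) W := hφ.deriv_of_isOpen hW (by norm_num)
  have hφ₂ : ContDiffOn ℝ 1 (deriv (deriv φ)) W := hφ₁.deriv_of_isOpen hW (by norm_num)
  have hφ₃ : ContDiffOn ℝ 0 (deriv (deriv (deriv φ))) W := hφ₂.deriv_of_isOpen hW (by norm_num)
  have hasD : ∀ {g : ℝ → ℝ} {n : WithTop ℕ∞}, ContDiffOn ℝ n g W → n ≠ 0 →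
      ∀ x ∈ W, HasDerivAt g (deriv g x) x := fun hg hn x hx =>
    ((hg.differentiableOn hn).differentiableAt (hW.mem_nhds hx)).hasDerivAt
  have hD₁ := hasD hφ (by norm_num)
  have hD₂ := hasD hφ₁ (by norm_num)
  have hD₃ := hasD hφ₂ (by norm_num)
  have cont : ∀ {g : ℝ → ℝ}, ContinuousOn g W → Tendsto g (𝓝[≠] c) (𝓝 (g c)) := fun hg =>
    (hg.continuousAt (hW.mem_nhds hcW)).tendsto.mono_left nhdsWithin_le_nhds
  have t₁ := cont hφ₁.continuousOn
  have t₂ := cont hφ₂.continuousOn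
  have t₃ := cont hφ₃.continuousOn
  have hc' := hφ' c hcW
  have hne : ∀ x ∈ W \ {c}, φ x ≠ 0 := fun x hx h =>
    hx.2 (hφinj hx.1 hcW (h.trans hφc.symm))
  have tslope : Tendsto (slope φ c) (𝓝[≠] c) (𝓝 (deriv φ c)) :=
    hasDerivAt_iff_tendsto_slope.mp (hD₁ c hcW)
  have tsub : Tendsto (fun x => (x - c) ^ 2) (𝓝[≠] c) (𝓝 0) := by
    have : ContinuousAt (fun x : ℝ => (x - c) ^ 2) c := by fun_prop
    simpa using this.tendsto.mono_left nhdsWithin_le_nhds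
  have tlim : Tendsto (fun x => (x - c) ^ 2 * (deriv (deriv (deriv φ)) x / deriv φ x
      - (3 / 2) * (deriv (deriv φ) x / deriv φ x) ^ 2)
      - (d ^ 2 - 1) / 2 * (deriv φ x / slope φ c x) ^ 2) (𝓝[≠] c) (𝓝 (-((d ^ 2 - 1) / 2))) := by
    have h := (tsub.mul ((t₃.div t₁ hc').sub (((t₂.div t₁ hc').pow 2).const_mul (3 / 2)))).sub
      (((t₁.div tslope hc').pow 2).const_mul ((d ^ 2 - 1) / 2))
    simpa [div_self hc'] using h
  have hK : 0 < (d ^ 2 - 1) / 4 := by nlinarith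
  have hev := tlim.eventually_lt_const (show -((d ^ 2 - 1) / 2) < -((d ^ 2 - 1) / 4) by linarith)
  obtain ⟨O, hO, hOo, hcO⟩ := eventually_nhds_iff.mp (eventually_nhdsWithin_iff.mp hev)
  refine ⟨O ∩ W, hOo.inter hW, ⟨hcO, hcW⟩, inter_subset_right, (d ^ 2 - 1) / 4, hK, ?_⟩
  intro x hx hxc
  have hxV : x ∈ W \ {c} := ⟨hx.2, hxc⟩
  have hsub : x - c ≠ 0 := sub_ne_zero.mpr hxc
  have hsq : 0 < (x - c) ^ 2 := by positivity
  have hS := schwarzian_add_mul_abs_rpow (hW.sdiff isClosed_singleton) (by linarith : d ≠ 0)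
    (fun y hy => hD₁ y hy.1) (fun y hy => hD₂ y hy.1) (fun y hy => hD₃ y hy.1) hne
    (fun y hy => hφ' y hy.1) (fun y hy => heq y hy.1) hxV
  have hlt : schwarzian f x < -((d ^ 2 - 1) / 4) / (x - c) ^ 2 := by
    rw [lt_div_iff₀ hsq, hS]
    refine lt_of_eq_of_lt ?_ (hO x hx.1 hxc)
    have := hne x hxV
    rw [slope_def_field, hφc, sub_zero]
    field_simp
  exact ⟨hlt, hlt.trans (div_neg_of_neg_of_pos (neg_lt_zero.mpr hK) hsq)⟩
end
end

section
/- Let f be a C³ real map with a non-flat critical point c of degree d > 1, i.e., f(x) = f(c) + φ(x)|φ(x)|^{d−1} on a neighborhood W of c, where φ: W → φ(W) is a C³ diffeomorphism with φ(c) = 0, and assume f is increasing. Then there exists a neighborhood U ⊆ W of c such that for every non-empty interval J ⊆ U and every x ∈ J one has Df(x) ≤ 3d |f(J)|/|J|. -/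
open Set Filter Topology
open scoped ENNReal

noncomputable section

open MCircle

/-- The increasing power map `y ↦ y |y| ^ r` has derivative `(r + 1) |y| ^ r`, also at `0`. -/
theorem hasDerivAt_mul_abs_rpow {r : ℝ} (hr : 0 < r) (y : ℝ) :
    HasDerivAt (fun t : ℝ => t * |t| ^ r) ((r + 1) * |y| ^ r) y := by
  rcases eq_or_ne y 0 with rfl | hy
  · rw [hasDerivAt_iff_tendsto_slope]
    have hcont : Tendsto (fun t : ℝ => |t| ^ r) (𝓝[≠] 0) (𝓝 ((r + 1) * |(0 : ℝ)| ^ r)) := by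
      have h : Continuous fun t : ℝ => |t| ^ r :=
        continuous_abs.rpow_const fun _ => Or.inr hr.le
      simpa [Real.zero_rpow hr.ne'] using (h.tendsto 0).mono_left nhdsWithin_le_nhds
    refine hcont.congr' ?_
    filter_upwards [self_mem_nhdsWithin] with t ht
    have ht' : t ≠ 0 := ht
    simp [slope_def_field, ht']
  · have habs : 0 < |y| := abs_pos.mpr hy
    have h := (hasDerivAt_id y).mul ((hasDerivAt_abs hy).rpow_const (p := r) (Or.inl habs.ne'))
    refine h.congr_deriv ?_
    have hsign : y * (SignType.sign y : ℝ) = |y| := self_mul_sign y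
    have hpow : |y| * |y| ^ (r - 1) = |y| ^ r := by
      rw [Real.rpow_sub_one habs.ne']
      field_simp
    simp only [id]
    linear_combination (r * |y| ^ (r - 1)) * hsign + r * hpow

/-- On an interval `[A, B]`, the power `|X| ^ r` is at most twice the mean slope of
`y ↦ y |y| ^ r`. -/
theorem abs_rpow_mul_sub_le {r A B X : ℝ} (hr : 0 ≤ r) (hA : A ≤ X) (hB : X ≤ B) :
    |X| ^ r * (B - A) ≤ 2 * (B * |B| ^ r - A * |A| ^ r) := by
  have hu : 0 ≤ |A| ^ r := by positivity
  have hv : 0 ≤ |B| ^ r := by positivity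
  rcases (hA.trans hB).eq_or_lt with rfl | hlt
  · simp
  rcases le_total |A| |B| with h | h
  · have huv : |A| ^ r ≤ |B| ^ r := Real.rpow_le_rpow (abs_nonneg _) h hr
    have hX : |X| ^ r ≤ |B| ^ r :=
      Real.rpow_le_rpow (abs_nonneg _) ((abs_le_max_abs_abs hA hB).trans_eq (max_eq_right h)) hr
    refine (mul_le_mul_of_nonneg_right hX (by linarith)).trans ?_
    have hAB : 0 ≤ A + B := by
      rcases abs_cases A with h1 | h1 <;> rcases abs_cases B with h2 | h2 <;> linarith
    rcases le_total 0 A with h0 | h0 <;> nlinarith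
  · have huv : |B| ^ r ≤ |A| ^ r := Real.rpow_le_rpow (abs_nonneg _) h hr
    have hX : |X| ^ r ≤ |A| ^ r :=
      Real.rpow_le_rpow (abs_nonneg _) ((abs_le_max_abs_abs hA hB).trans_eq (max_eq_left h)) hr
    refine (mul_le_mul_of_nonneg_right hX (by linarith)).trans ?_
    have hAB : A + B ≤ 0 := by
      rcases abs_cases A with h1 | h1 <;> rcases abs_cases B with h2 | h2 <;> linarith
    rcases le_total 0 B with h0 | h0 <;> nlinarith

/-- **Macroscopic derivative bound near a non-flat critical point** (Lemma 2.4,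
item 3). If `f` is an increasing `C³` map with a non-flat critical point `c` of degree
`d > 1`, i.e. `f(x) = f(c) + φ(x)|φ(x)|^{d-1}` on a neighbourhood `W` of `c` with `φ`
a `C³` diffeo, `φ(c) = 0`, then there is a neighbourhood `U ⊆ W` of `c` such that for
every nonempty interval `J = [a,b] ⊆ U` and every `x ∈ J`,
`Df(x) ≤ 3d |f(J)|/|J|`. -/
theorem nonflat_deriv_macroscopic (f φ : ℝ → ℝ) (c d : ℝ) (W : Set ℝ)
    (hf : ContDiff ℝ 3 f) (hmono : StrictMono f) (hd : 1 < d)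
    (hW : IsOpen W) (hcW : c ∈ W)
    (hφ : ContDiffOn ℝ 3 φ W) (hφc : φ c = 0) (hφ' : ∀ x ∈ W, deriv φ x ≠ 0)
    (hφinj : InjOn φ W)
    (heq : ∀ x ∈ W, f x = f c + φ x * |φ x| ^ (d - 1)) :
    ∃ U : Set ℝ, IsOpen U ∧ c ∈ U ∧ U ⊆ W ∧
      ∀ a b : ℝ, a < b → Icc a b ⊆ U → ∀ x ∈ Icc a b,
        deriv f x ≤ 3 * d * ((f b - f a) / (b - a)) := by
  have hdiff : ∀ x ∈ W, DifferentiableAt ℝ φ x := fun x hx =>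
    (hφ.contDiffAt (hW.mem_nhds hx)).differentiableAt (by norm_num)
  have hcont : ContinuousAt (deriv φ) c :=
    (hφ.continuousOn_deriv_of_isOpen hW (by norm_num)).continuousAt (hW.mem_nhds hcW)
  set p := deriv φ c with hp
  have hp0 : 0 < |p| := abs_pos.mpr (hφ' c hcW)
  obtain ⟨ε, hε, hball⟩ := Metric.eventually_nhds_iff_ball.mp
    ((Metric.continuousAt_iff'.mp hcont (|p| / 5) (by positivity)).and (hW.mem_nhds hcW))
  have hbW : Metric.ball c ε ⊆ W := fun x hx => (hball x hx).2
  have hclose : ∀ x ∈ Metric.ball c ε, |deriv φ x - p| < |p| / 5 := fun x hx => (hball x hx).1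
  have hφcont : ContinuousOn φ (Metric.ball c ε) := hφ.continuousOn.mono hbW
  have hcU : c ∈ Metric.ball c ε := Metric.mem_ball_self hε
  have hpos : 0 < p := by
    by_contra hneg
    have hanti : StrictAntiOn φ (Metric.ball c ε) := by
      refine strictAntiOn_of_deriv_neg (convex_ball c ε) hφcont fun x hx => ?_
      have h := (abs_lt.mp (hclose x (interior_subset hx))).2
      rw [abs_of_nonpos (not_lt.mp hneg)] at h hp0
      linarith
    have hxU : c + ε / 2 ∈ Metric.ball c ε := by
      rw [Metric.mem_ball, Real.dist_eq, add_sub_cancel_left, abs_of_pos (by positivity)]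
      linarith
    have hlt : φ (c + ε / 2) < 0 := hφc ▸ hanti hcU hxU (by linarith)
    have hflt : f c < f (c + ε / 2) := hmono (by linarith)
    rw [heq _ (hbW hxU)] at hflt
    have : 0 ≤ |φ (c + ε / 2)| ^ (d - 1) := by positivity
    nlinarith
  rw [abs_of_pos hpos] at hclose
  refine ⟨Metric.ball c ε, Metric.isOpen_ball, hcU, hbW, fun a b hab hJ x hx => ?_⟩
  have haJ : a ∈ Icc a b := left_mem_Icc.mpr hab.le
  have hbJ : b ∈ Icc a b := right_mem_Icc.mpr hab.le
  have hlow : ∀ y ∈ Metric.ball c ε, 4 / 5 * p ≤ deriv φ y := fun y hy => by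
    linarith [(abs_lt.mp (hclose y hy)).1]
  have hφmono : MonotoneOn φ (Icc a b) := by
    refine monotoneOn_of_deriv_nonneg (convex_Icc a b) (hφcont.mono hJ)
      (fun y hy => (hdiff y (hbW (hJ (interior_subset hy)))).differentiableWithinAt)
      fun y hy => ?_
    linarith [hlow y (hJ (interior_subset hy))]
  have hmean : 4 / 5 * p * (b - a) ≤ φ b - φ a :=
    (convex_Icc a b).mul_sub_le_image_sub_of_le_deriv (hφcont.mono hJ)
      (fun y hy => (hdiff y (hbW (hJ (interior_subset hy)))).differentiableWithinAt)
      (fun y hy => hlow y (hJ (interior_subset hy))) a haJ b hbJ hab.le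
  have hslope := abs_rpow_mul_sub_le (sub_nonneg.mpr hd.le)
    (hφmono haJ hx hx.1) (hφmono hx hbJ hx.2)
  have hderiv : deriv f x = d * |φ x| ^ (d - 1) * deriv φ x := by
    have h := ((hasDerivAt_mul_abs_rpow (sub_pos.mpr hd) (φ x)).comp x
      (hdiff x (hbW (hJ hx))).hasDerivAt).const_add (f c)
    rw [sub_add_cancel] at h
    refine (h.congr_of_eventuallyEq ?_).deriv
    filter_upwards [hW.mem_nhds (hbW (hJ hx))] with y hy using heq y hy
  have hup : deriv φ x ≤ 6 / 5 * p := by linarith [(abs_lt.mp (hclose x (hJ hx))).2]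
  have hd0 : 0 < d := by linarith
  have hba : 0 < b - a := sub_pos.mpr hab
  have hfab : f b - f a = φ b * |φ b| ^ (d - 1) - φ a * |φ a| ^ (d - 1) := by
    rw [heq b (hbW (hJ hbJ)), heq a (hbW (hJ haJ))]
    ring
  rw [hderiv, ← mul_div_assoc, le_div_iff₀ hba, hfab]
  set v := |φ x| ^ (d - 1)
  have hv : 0 ≤ v := by positivity
  calc d * v * deriv φ x * (b - a)
      ≤ d * v * (6 / 5 * p) * (b - a) := by gcongr
    _ = 3 / 2 * d * (v * (4 / 5 * p * (b - a))) := by ring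
    _ ≤ 3 / 2 * d * (v * (φ b - φ a)) := by gcongr
    _ ≤ 3 / 2 * d * (2 * (φ b * |φ b| ^ (d - 1) - φ a * |φ a| ^ (d - 1))) := by gcongr
    _ = 3 * d * (φ b * |φ b| ^ (d - 1) - φ a * |φ a| ^ (d - 1)) := by ring
end
end

section
/- Let f be a C³ real map with a non-flat critical point c of degree d > 1, i.e., f(x) = f(c) + φ(x)|φ(x)|^{d−1} on a neighborhood W of c, where φ: W → φ(W) is a C³ diffeomorphism with φ(c) = 0, and assume f is increasing. Then there exists a neighborhood U ⊆ W of c such that for any two intervals M ⋐ T ⊆ U one has CrD(f; M, T) ≤ 9d². -/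
open Set Filter Topology
open scoped ENNReal

noncomputable section

open MCircle

/-- The odd power map `t ↦ t|t|^e` has difference quotients at most `(e+1) m^e`, where `m` is the
largest absolute value of the endpoints. -/
lemma mul_abs_rpow_sub_le {e a b : ℝ} (he : 0 < e) (hab : a < b) :
    b * |b| ^ e - a * |a| ^ e ≤ (e + 1) * max |a| |b| ^ e * (b - a) := by
  have key : ∀ {a b : ℝ}, 0 ≤ a → a < b → b * b ^ e - a * a ^ e ≤ (e + 1) * b ^ e * (b - a) := by
    intro a b ha hab
    have hb : 0 < b := ha.trans_lt hab
    have h := one_add_mul_self_le_rpow_one_add (s := a / b - 1) (p := e + 1)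
      (by have := div_nonneg ha hb.le; linarith) (by linarith)
    rw [add_sub_cancel, Real.div_rpow ha hb.le, le_div_iff₀ (by positivity),
      Real.rpow_add_one' hb.le (by linarith), Real.rpow_add_one' ha (by linarith)] at h
    have h2 : (1 + (e + 1) * (a / b - 1)) * (b ^ e * b) = b ^ e * (b + (e + 1) * (a - b)) := by
      field_simp
    rw [h2] at h
    linarith
  rcases le_or_gt 0 a with ha | ha
  · rw [abs_of_nonneg ha, abs_of_pos (ha.trans_lt hab), max_eq_right hab.le]
    exact key ha hab
  rcases le_or_gt b 0 with hb | hb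
  · rw [abs_of_neg ha, abs_of_nonpos hb, max_eq_left (by linarith)]
    have := key (a := -b) (b := -a) (by linarith) (by linarith)
    linarith
  · have h1 : |b| ^ e ≤ max |a| |b| ^ e :=
      Real.rpow_le_rpow (abs_nonneg _) (le_max_right _ _) he.le
    have h2 : |a| ^ e ≤ max |a| |b| ^ e :=
      Real.rpow_le_rpow (abs_nonneg _) (le_max_left _ _) he.le
    have h3 : 0 ≤ max |a| |b| ^ e := by positivity
    have h4 : 0 ≤ e * (max |a| |b| ^ e * (b - a)) :=
      mul_nonneg he.le (mul_nonneg h3 (by linarith))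
    nlinarith [mul_le_mul_of_nonneg_left h1 hb.le,
      mul_le_mul_of_nonneg_left h2 (neg_nonneg.2 ha.le)]

/-- The odd power map `t ↦ t|t|^e` has difference quotients at least `m^e / 2`, where `m` is the
largest absolute value of the endpoints. -/
lemma le_mul_abs_rpow_sub {e a b : ℝ} (he : 0 < e) (hab : a < b) :
    max |a| |b| ^ e / 2 * (b - a) ≤ b * |b| ^ e - a * |a| ^ e := by
  have hA : 0 ≤ |a| ^ e := by positivity
  have hB : 0 ≤ |b| ^ e := by positivity
  rcases le_total |a| |b| with h | h
  · have hm : |a| ^ e ≤ |b| ^ e := Real.rpow_le_rpow (abs_nonneg _) h he.le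
    rw [max_eq_right h]
    have hb : 0 < b := by
      by_contra! hb
      rw [abs_of_nonpos hb, abs_of_nonpos (by linarith)] at h
      linarith
    rw [abs_of_pos hb] at h
    have := neg_abs_le a
    rcases le_total 0 a with ha | ha <;> nlinarith
  · have hm : |b| ^ e ≤ |a| ^ e := Real.rpow_le_rpow (abs_nonneg _) h he.le
    rw [max_eq_left h]
    have ha : a < 0 := by
      by_contra! ha
      rw [abs_of_nonneg ha, abs_of_nonneg (by linarith)] at h
      linarith
    rw [abs_of_neg ha] at h
    have := le_abs_self b
    rcases le_total 0 b with hb | hb <;> nlinarith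

/-- A function with positive derivative pinched between `p` and `q` has difference quotients
pinched between `p` and `q`. -/
lemma mul_sub_le_sub_and_sub_le_mul_sub {g : ℝ → ℝ} {s : Set ℝ} {p q a b : ℝ}
    (hg : ∀ x ∈ s, DifferentiableAt ℝ g x) (hp : ∀ x ∈ s, p ≤ deriv g x)
    (hq : ∀ x ∈ s, deriv g x ≤ q) (hab : a < b) (hs : Icc a b ⊆ s) :
    p * (b - a) ≤ g b - g a ∧ g b - g a ≤ q * (b - a) := by
  obtain ⟨x, hx, hxe⟩ := exists_deriv_eq_slope g hab
    (fun x hx => (hg x (hs hx)).continuousAt.continuousWithinAt)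
    (fun x hx => (hg x (hs (Ioo_subset_Icc_self hx))).differentiableWithinAt)
  have h0 : 0 < b - a := sub_pos.2 hab
  rw [eq_div_iff h0.ne'] at hxe
  rw [← hxe]
  have hxs := hs (Ioo_subset_Icc_self hx)
  exact ⟨mul_le_mul_of_nonneg_right (hp x hxs) h0.le, mul_le_mul_of_nonneg_right (hq x hxs) h0.le⟩

/-- A bound on products of difference quotients bounds the cross-ratio distortion. -/
lemma crD_le_of_slopes {g : ℝ → ℝ} {u v w z K : ℝ} (hg : StrictMono g) (huv : u < v) (hvw : v < w)
    (hwz : w < z)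
    (h : (g v - g u) / (v - u) * ((g z - g w) / (z - w)) ≤
      K * ((g w - g u) / (w - u) * ((g z - g v) / (z - v)))) :
    crD g u v w z ≤ K := by
  have h1 := sub_pos.2 huv
  have h2 := sub_pos.2 hwz
  have h3 := sub_pos.2 (huv.trans hvw)
  have h4 := sub_pos.2 (hvw.trans hwz)
  have g3 := sub_pos.2 (hg (huv.trans hvw))
  have g4 := sub_pos.2 (hg (hvw.trans hwz))
  have : crD g u v w z = (g v - g u) / (v - u) * ((g z - g w) / (z - w)) /
      ((g w - g u) / (w - u) * ((g z - g v) / (z - v))) := by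
    unfold crD crossRatio
    field_simp
  rw [this, div_le_iff₀ (by positivity)]
  exact h

/-- **Bounded cross-ratio distortion near a non-flat critical point** (Lemma 2.4,
item 4). If `f` is an increasing `C³` map with a non-flat critical point `c` of
degree `d > 1`, i.e. `f(x) = f(c) + φ(x)|φ(x)|^{d-1}` on a neighbourhood `W` of `c`
with `φ` a `C³` diffeo, `φ(c) = 0`, then there is a neighbourhood `U ⊆ W` of `c`
such that for any intervals `M = [v,w] ⋐ T = [u,z] ⊆ U` one has
`CrD(f; M, T) ≤ 9d²`. -/
theorem nonflat_crD_bound (f φ : ℝ → ℝ) (c d : ℝ) (W : Set ℝ)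
    (hf : ContDiff ℝ 3 f) (hmono : StrictMono f) (hd : 1 < d)
    (hW : IsOpen W) (hcW : c ∈ W)
    (hφ : ContDiffOn ℝ 3 φ W) (hφc : φ c = 0) (hφ' : ∀ x ∈ W, deriv φ x ≠ 0)
    (hφinj : InjOn φ W)
    (heq : ∀ x ∈ W, f x = f c + φ x * |φ x| ^ (d - 1)) :
    ∃ U : Set ℝ, IsOpen U ∧ c ∈ U ∧ U ⊆ W ∧
      ∀ u v w z : ℝ, u < v → v < w → w < z → Icc u z ⊆ U →
        crD f u v w z ≤ 9 * d ^ 2 := by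
  obtain ⟨e, rfl⟩ : ∃ e, d = e + 1 := ⟨d - 1, by ring⟩
  have he : 0 < e := by linarith
  simp only [add_sub_cancel_right] at heq
  have hdiff : ∀ x ∈ W, DifferentiableAt ℝ φ x := fun x hx =>
    (hφ.differentiableOn (by norm_num)).differentiableAt (hW.mem_nhds hx)
  have hcont : ContinuousAt (deriv φ) c :=
    (hφ.continuousOn_deriv_of_isOpen hW (by norm_num)).continuousAt (hW.mem_nhds hcW)
  have hA0 : 0 < |deriv φ c| := abs_pos.2 (hφ' c hcW)
  have hnear : ∀ᶠ x in 𝓝 c, |deriv φ x - deriv φ c| < |deriv φ c| / 5 := by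
    simpa [Real.dist_eq] using Metric.tendsto_nhds.1 hcont (|deriv φ c| / 5) (by positivity)
  obtain ⟨r, hr, hball⟩ := Metric.eventually_nhds_iff_ball.1 (hnear.and (hW.mem_nhds hcW))
  have hA : 0 < deriv φ c := by
    by_contra! hneg
    rw [abs_of_nonpos hneg] at hA0 hball
    have hsub : Icc c (c + r / 2) ⊆ Metric.ball c r := fun x hx => by
      rw [Metric.mem_ball, Real.dist_eq, abs_lt]
      constructor <;> linarith [hx.1, hx.2]
    have hlt : c < c + r / 2 := by linarith
    have h1 := (mul_sub_le_sub_and_sub_le_mul_sub (g := φ) (p := 2 * deriv φ c) (q := 0)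
      (fun x hx => hdiff x (hball x hx).2)
      (fun x hx => by linarith [(abs_lt.1 (hball x hx).1).1])
      (fun x hx => by linarith [(abs_lt.1 (hball x hx).1).2]) hlt hsub).2
    have h2 := heq _ (hball _ (hsub (right_mem_Icc.2 hlt.le))).2
    have h3 := hmono hlt
    have h4 : φ (c + r / 2) * |φ (c + r / 2)| ^ e ≤ 0 :=
      mul_nonpos_of_nonpos_of_nonneg (by linarith) (by positivity)
    linarith
  rw [abs_of_pos hA] at hball
  set A := deriv φ c
  refine ⟨Metric.ball c r, Metric.isOpen_ball, Metric.mem_ball_self hr,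
    fun x hx => (hball x hx).2, fun u v w z huv hvw hwz hU => ?_⟩
  let M : ℝ → ℝ → ℝ := fun a b => max |φ a| |φ b| ^ e
  have hM0 : ∀ a b, 0 ≤ M a b := fun a b => by positivity
  have hφb : ∀ a b, u ≤ a → a < b → b ≤ z →
      4 / 5 * A * (b - a) ≤ φ b - φ a ∧ φ b - φ a ≤ 6 / 5 * A * (b - a) := fun a b ha hab hb =>
    mul_sub_le_sub_and_sub_le_mul_sub (fun x hx => hdiff x (hball x hx).2)
      (fun x hx => by linarith [(abs_lt.1 (hball x hx).1).1])
      (fun x hx => by linarith [(abs_lt.1 (hball x hx).1).2]) hab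
      ((Icc_subset_Icc ha hb).trans hU)
  have hφmono : ∀ a b, u ≤ a → a < b → b ≤ z → φ a < φ b := fun a b ha hab hb => by
    have : 0 < 4 / 5 * A * (b - a) := mul_pos (by positivity) (sub_pos.2 hab)
    linarith [(hφb a b ha hab hb).1]
  have hfsub : ∀ a b, u ≤ a → a < b → b ≤ z →
      f b - f a = φ b * |φ b| ^ e - φ a * |φ a| ^ e := fun a b ha hab hb => by
    rw [heq a (hball a (hU ⟨ha, hab.le.trans hb⟩)).2, heq b (hball b (hU ⟨ha.trans hab.le, hb⟩)).2]
    ring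
  have hup : ∀ a b, u ≤ a → a < b → b ≤ z →
      (f b - f a) / (b - a) ≤ (e + 1) * M a b * (6 / 5 * A) := fun a b ha hab hb => by
    rw [div_le_iff₀ (sub_pos.2 hab), hfsub a b ha hab hb, mul_assoc]
    exact (mul_abs_rpow_sub_le he (hφmono a b ha hab hb)).trans
      (mul_le_mul_of_nonneg_left (hφb a b ha hab hb).2 (by positivity))
  have hlo : ∀ a b, u ≤ a → a < b → b ≤ z →
      M a b / 2 * (4 / 5 * A) ≤ (f b - f a) / (b - a) := fun a b ha hab hb => by
    rw [le_div_iff₀ (sub_pos.2 hab), hfsub a b ha hab hb, mul_assoc]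
    exact (mul_le_mul_of_nonneg_left (hφb a b ha hab hb).1 (by positivity)).trans
      (le_mul_abs_rpow_sub he (hφmono a b ha hab hb))
  have hslope : ∀ a b, a < b → 0 ≤ (f b - f a) / (b - a) := fun a b hab =>
    div_nonneg (sub_nonneg.2 (hmono hab).le) (sub_nonneg.2 hab.le)
  have huw := huv.trans hvw
  have hvz := hvw.trans hwz
  have hM : M u v * M w z ≤ M u w * M v z := by
    refine mul_le_mul (Real.rpow_le_rpow (by positivity) ?_ he.le)
      (Real.rpow_le_rpow (by positivity) ?_ he.le) (hM0 _ _) (hM0 _ _)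
    · exact max_le (le_max_left _ _) (abs_le_max_abs_abs (hφmono u v le_rfl huv hvz.le).le
        (hφmono v w huv.le hvw hwz.le).le)
    · exact max_le (abs_le_max_abs_abs (hφmono v w huv.le hvw hwz.le).le
        (hφmono w z huw.le hwz le_rfl).le) (le_max_right _ _)
  refine crD_le_of_slopes hmono huv hvw hwz ?_
  calc (f v - f u) / (v - u) * ((f z - f w) / (z - w))
      ≤ ((e + 1) * M u v * (6 / 5 * A)) * ((e + 1) * M w z * (6 / 5 * A)) :=
        mul_le_mul (hup u v le_rfl huv hvz.le) (hup w z huw.le hwz le_rfl) (hslope w z hwz)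
          (by positivity)
    _ = (36 / 25 * (e + 1) ^ 2 * A ^ 2) * (M u v * M w z) := by ring
    _ ≤ (36 / 25 * (e + 1) ^ 2 * A ^ 2) * (M u w * M v z) :=
        mul_le_mul_of_nonneg_left hM (by positivity)
    _ = 9 * (e + 1) ^ 2 * ((M u w / 2 * (4 / 5 * A)) * (M v z / 2 * (4 / 5 * A))) := by ring
    _ ≤ 9 * (e + 1) ^ 2 * ((f w - f u) / (w - u) * ((f z - f v) / (z - v))) :=
        mul_le_mul_of_nonneg_left
          (mul_le_mul (hlo u w le_rfl huw hwz.le) (hlo v z huv.le hvz le_rfl) (by positivity)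
            (hslope u w huw)) (by positivity)
end
end
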